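/- arXiv:1801.10087 — 3 statements merged into one kernel-verified Lean document; each statement's English description precedes it below -/
import Mathlib

section
/- For every population size function µ = µ(n) with µ = o(n/log n), the probability that the (µ+1) EA (with no diversity mechanism) run on TwoMax creates both optima 0^n and 1^n within n^{n-1} generations tends to 0 as n → ∞, and the expected number of generations until both optima have been created is Ω(n^n). -/
open Filter
open scoped ENNReal BigOperators Classical

noncomputable section

abbrev BitString (n : ℕ) := Fin n → Bool

def onesCount {n : ℕ} (x : BitString n) : ℕ := (Finset.univ.filter fun i => x i = true).card

def allOnes (n : ℕ) : BitString n := fun _ => true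
def allZeros (n : ℕ) : BitString n := fun _ => false

def twoMax {n : ℕ} (x : BitString n) : ℕ := max (onesCount x) (n - onesCount x)

/-- probability that standard bit mutation with rate `1/n` creates `y` from `x` -/
def mutProb (n : ℕ) (x y : BitString n) : ℝ≥0∞ :=
  ((n : ℝ≥0∞)⁻¹) ^ hammingDist x y * (1 - (n : ℝ≥0∞)⁻¹) ^ (n - hammingDist x y)

/-- distribution of a (time-homogeneous) finite Markov chain after `t` steps -/
def evolve {S : Type*} [Fintype S] (init : S → ℝ≥0∞) (trans : S → S → ℝ≥0∞) : ℕ → S → ℝ≥0∞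
  | 0 => init
  | t + 1 => fun s' => ∑ s, evolve init trans t s * trans s s'

/-- probability of an event under a (sub)distribution -/
def probOf {S : Type*} [Fintype S] (d : S → ℝ≥0∞) (A : S → Prop) : ℝ≥0∞ :=
  ∑ s, if A s then d s else 0

end

noncomputable section

namespace Stmt0

/-- State of a run: the current population, together with two flags recording whether
the all-zeros string resp. the all-ones string has already been created
(as an initial population member or as an offspring). -/
abbrev State (n μ : ℕ) := (Fin μ → BitString n) × Bool × Bool

/-- indices of population members of worst fitness -/
def worstIdx {n μ : ℕ} (f : BitString n → ℕ) (P : Fin μ → BitString n) : Finset (Fin μ) :=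
  Finset.univ.filter fun j => ∀ i, f (P j) ≤ f (P i)

/-- One generation of the (μ+1) EA on TwoMax: choose a parent uniformly at random,
mutate it, choose an individual of worst fitness uniformly at random and replace it by
the offspring if the offspring is at least as fit; the flags record creation of the optima. -/
def trans (n μ : ℕ) : State n μ → State n μ → ℝ≥0∞ := fun s s' =>
  ∑ i : Fin μ, (μ : ℝ≥0∞)⁻¹ * ∑ y : BitString n, mutProb n (s.1 i) y *
    ∑ j ∈ worstIdx twoMax s.1, ((worstIdx twoMax s.1).card : ℝ≥0∞)⁻¹ *
      (if s'.1 = (if twoMax (s.1 j) ≤ twoMax y then Function.update s.1 j y else s.1) ∧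
          s'.2.1 = (s.2.1 || decide (y = allZeros n)) ∧
          s'.2.2 = (s.2.2 || decide (y = allOnes n))
        then 1 else 0)

/-- Initialization: the population is uniform over all populations of μ bit strings of
length n; the flags record whether an optimum is already present initially. -/
def init (n μ : ℕ) : State n μ → ℝ≥0∞ := fun s =>
  ((2 : ℝ≥0∞) ^ (n * μ))⁻¹ *
    (if s.2.1 = decide (∃ i, s.1 i = allZeros n) ∧ s.2.2 = decide (∃ i, s.1 i = allOnes n)
      then 1 else 0)

/-- both optima have been created -/
def bothFound {n μ : ℕ} (s : State n μ) : Prop := s.2.1 = true ∧ s.2.2 = true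

/-- probability that both optima of TwoMax have been created within `T` generations -/
def findBothProb (n μ T : ℕ) : ℝ≥0∞ :=
  probOf (evolve (init n μ) (trans n μ) T) bothFound

/-- expected number of generations until both optima of TwoMax have been created -/
def expFindBoth (n μ : ℕ) : ℝ≥0∞ :=
  ∑' T : ℕ, probOf (evolve (init n μ) (trans n μ) T) fun s => ¬ bothFound s

/-- next state -/
def nextS {n μ : ℕ} (s : State n μ) (y : BitString n) (j : Fin μ) : State n μ :=
  ((if twoMax (s.1 j) ≤ twoMax y then Function.update s.1 j y else s.1),
    (s.2.1 || decide (y = allZeros n)), (s.2.2 || decide (y = allOnes n)))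

/-- averaging over one generation -/
def avg {n μ : ℕ} (P : Fin μ → BitString n) (F : BitString n → Fin μ → ℝ≥0∞) : ℝ≥0∞ :=
  ∑ i : Fin μ, (μ : ℝ≥0∞)⁻¹ * ∑ y : BitString n, mutProb n (P i) y *
    ∑ j ∈ worstIdx twoMax P, ((worstIdx twoMax P).card : ℝ≥0∞)⁻¹ * F y j

lemma trans_avg {n μ : ℕ} (s : State n μ) (G : State n μ → ℝ≥0∞) :
    ∑ s', trans n μ s s' * G s' = avg s.1 (fun y j => G (nextS s y j)) := by
  have key : ∀ y j, ∑ s' : State n μ, (if s'.1 = (if twoMax (s.1 j) ≤ twoMax y then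
      Function.update s.1 j y else s.1) ∧ s'.2.1 = (s.2.1 || decide (y = allZeros n)) ∧
          s'.2.2 = (s.2.2 || decide (y = allOnes n)) then (1 : ℝ≥0∞) else 0) * G s' =
        G (nextS s y j) := by
    intro y j
    rw [Finset.sum_eq_single (nextS s y j)]
    · simp [nextS]
    · intro s' _ hne
      rw [if_neg, zero_mul]
      rintro ⟨h1, h2, h3⟩
      exact hne (Prod.ext h1 (Prod.ext h2 h3))
    · simp
  unfold trans avg
  simp only [← key, Finset.sum_mul, Finset.mul_sum]
  rw [Finset.sum_comm]
  refine Finset.sum_congr rfl fun i _ => ?_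
  rw [Finset.sum_comm]
  refine Finset.sum_congr rfl fun y _ => ?_
  rw [Finset.sum_comm]
  refine Finset.sum_congr rfl fun j _ => ?_
  refine Finset.sum_congr rfl fun s' _ => ?_
  simp only [mul_assoc]

lemma worst_nonempty {n μ : ℕ} (hμ : 1 ≤ μ) (P : Fin μ → BitString n) :
    (worstIdx twoMax P).Nonempty := by
  have : Nonempty (Fin μ) := ⟨⟨0, hμ⟩⟩
  obtain ⟨j, hj⟩ := Finite.exists_min (fun i => twoMax (P i))
  exact ⟨j, by simp [worstIdx, hj]⟩

lemma avg_y {n μ : ℕ} (hμ : 1 ≤ μ) (P : Fin μ → BitString n) (F : BitString n → ℝ≥0∞) :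
    avg P (fun y _ => F y) = ∑ i : Fin μ, (μ : ℝ≥0∞)⁻¹ * ∑ y, mutProb n (P i) y * F y := by
  unfold avg
  refine Finset.sum_congr rfl fun i _ => ?_
  congr 1
  refine Finset.sum_congr rfl fun y _ => ?_
  congr 1
  rw [Finset.sum_const, nsmul_eq_mul, ← mul_assoc, ENNReal.mul_inv_cancel, one_mul]
  · have := (worst_nonempty hμ P).card_pos
    exact_mod_cast this.ne'
  · simp

lemma avg_mono {n μ : ℕ} (P : Fin μ → BitString n) {F G : BitString n → Fin μ → ℝ≥0∞}
    (h : ∀ y, ∀ j ∈ worstIdx twoMax P, F y j ≤ G y j) : avg P F ≤ avg P G := by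
  unfold avg
  gcongr with i _ y _ j hj
  exact h y j hj

lemma avg_add {n μ : ℕ} (P : Fin μ → BitString n) (F G : BitString n → Fin μ → ℝ≥0∞) :
    avg P (fun y j => F y j + G y j) = avg P F + avg P G := by
  unfold avg
  simp only [mul_add, Finset.sum_add_distrib]

lemma n_inv_le {n : ℕ} (hn : 2 ≤ n) : (n : ℝ≥0∞)⁻¹ ≤ 1 := by
  rw [ENNReal.inv_le_one]; exact_mod_cast (by omega : 1 ≤ n)

lemma mutProb_prod (n : ℕ) (x y : BitString n) :
    mutProb n x y = ∏ i, (if x i ≠ y i then (n : ℝ≥0∞)⁻¹ else 1 - (n : ℝ≥0∞)⁻¹) := by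
  rw [Finset.prod_ite, Finset.prod_const, Finset.prod_const]
  have h1 : (Finset.univ.filter fun i => x i ≠ y i).card = hammingDist x y := by
    unfold hammingDist; congr
  have h2 := Finset.card_filter_add_card_filter_not (s := (Finset.univ : Finset (Fin n)))
    (fun i => x i ≠ y i)
  rw [Finset.card_univ, Fintype.card_fin, h1] at h2
  unfold mutProb
  rw [h1]
  congr 2
  omega

lemma mutProb_sum {n : ℕ} (hn : 2 ≤ n) (x : BitString n) : ∑ y, mutProb n x y = 1 := by
  simp_rw [mutProb_prod]
  rw [← Fintype.prod_sum (fun i (b : Bool) => if x i ≠ b then (n : ℝ≥0∞)⁻¹ else 1 - (n : ℝ≥0∞)⁻¹)]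
  refine Finset.prod_eq_one fun i _ => ?_
  have := n_inv_le hn
  cases x i <;> simp [this, tsub_add_cancel_of_le, add_tsub_cancel_of_le]

lemma mutProb_le {n : ℕ} (hn : 2 ≤ n) {x y : BitString n} (h : x ≠ y) :
    mutProb n x y ≤ (n : ℝ≥0∞)⁻¹ := by
  have hd : hammingDist x y ≠ 0 := by simpa using h
  unfold mutProb
  calc _ ≤ (n : ℝ≥0∞)⁻¹ ^ 1 * 1 := by
        gcongr ?_ * ?_
        · exact pow_le_pow_of_le_one (by simp) (n_inv_le hn) (by omega)
        · exact pow_le_one₀ (by simp) tsub_le_self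
    _ = _ := by simp

lemma mutProb_self {n : ℕ} (hn : 2 ≤ n) (x : BitString n) :
    (4 : ℝ≥0∞)⁻¹ ≤ mutProb n x x := by
  have key : (1 / 4 : ℝ) ≤ (1 - (n : ℝ)⁻¹) ^ n := by
    -- (1-1/n)^n ≥ 1/4
    have hn' : (2 : ℝ) ≤ n := by exact_mod_cast hn
    have hi : (n : ℝ)⁻¹ ≤ 1 / 2 := by
      rw [inv_le_comm₀ (by positivity) (by norm_num)]; simpa using hn'
    obtain ⟨m, rfl | rfl⟩ := Nat.even_or_odd' n
    · have hb := one_add_mul_le_pow (a := -((2 * m : ℕ) : ℝ)⁻¹) (by linarith) m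
      have hm : (m : ℝ) * ((2 * m : ℕ) : ℝ)⁻¹ = 1 / 2 := by
        have : (m : ℝ) ≠ 0 := by
          intro h; push_cast at hn'; linarith
        push_cast; field_simp
      have : (1 / 2 : ℝ) ≤ (1 - ((2 * m : ℕ) : ℝ)⁻¹) ^ m := by
        rw [sub_eq_add_neg]; nlinarith
      rw [mul_comm 2 m, pow_mul, mul_comm m 2]
      nlinarith
    · have hm1 : 1 ≤ m := by omega
      have hm1' : (1 : ℝ) ≤ m := by exact_mod_cast hm1
      set q := ((2 * m + 1 : ℕ) : ℝ)⁻¹ with hq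
      have hq' : q * (2 * m + 1) = 1 := by
        rw [hq]; push_cast; field_simp
      have hb := one_add_mul_le_pow (a := -q) (by linarith) m
      have hb1 : 1 - m * q ≤ (1 - q) ^ m := by
        rw [sub_eq_add_neg 1 q]; linarith
      have e : 1 - m * q = 1 / 2 + q / 2 := by linarith
      have hq0 : 0 < q := by rw [hq]; positivity
      have : (1 - q) ^ (2 * m + 1) = ((1 - q) ^ m) ^ 2 * (1 - q) := by ring
      rw [this]
      have h3 : (1 / 2 + q / 2) ^ 2 ≤ ((1 - q) ^ m) ^ 2 := by
        apply pow_le_pow_left₀ (by positivity); linarith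
      have h4 : (1 / 2 + q / 2) ^ 2 * (1 - q) ≤ ((1 - q) ^ m) ^ 2 * (1 - q) :=
        mul_le_mul_of_nonneg_right h3 (by linarith)
      have : (1 / 4 : ℝ) ≤ (1 / 2 + q / 2) ^ 2 * (1 - q) := by
        nlinarith [mul_nonneg hq0.le (by nlinarith : (0 : ℝ) ≤ 1 - q - q ^ 2)]
      linarith
  have hn0 : (0 : ℝ) < n := by exact_mod_cast (by omega : 0 < n)
  have e : mutProb n x x = ENNReal.ofReal ((1 - (n : ℝ)⁻¹) ^ n) := by
    have h1 : (n : ℝ)⁻¹ ≤ 1 := by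
      apply inv_le_one_of_one_le₀; exact_mod_cast (by omega : 1 ≤ n)
    rw [ENNReal.ofReal_pow (by linarith), ENNReal.ofReal_sub _ (by positivity),
      ENNReal.ofReal_inv_of_pos hn0]
    simp [mutProb]
  rw [e]
  calc (4 : ℝ≥0∞)⁻¹ = ENNReal.ofReal (1 / 4) := by
        rw [one_div, ENNReal.ofReal_inv_of_pos (by norm_num)]; simp
    _ ≤ _ := ENNReal.ofReal_le_ofReal key

lemma mutProb_opp {n : ℕ} {x y : BitString n} (h : ∀ i, x i ≠ y i) :
    mutProb n x y = ((n : ℝ≥0∞) ^ n)⁻¹ := by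
  rw [mutProb_prod]
  simp [h, ENNReal.inv_pow]

lemma inv_mul_card {μ : ℕ} (hμ : 1 ≤ μ) (c : ℝ≥0∞) :
    ∑ _i : Fin μ, (μ : ℝ≥0∞)⁻¹ * c = c := by
  rw [Finset.sum_const, nsmul_eq_mul, ← mul_assoc, Finset.card_univ, Fintype.card_fin,
    ENNReal.mul_inv_cancel, one_mul]
  · exact_mod_cast (by omega : μ ≠ 0)
  · simp

lemma avg_const {n μ : ℕ} (hn : 2 ≤ n) (hμ : 1 ≤ μ) (P : Fin μ → BitString n) (c : ℝ≥0∞) :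
    avg P (fun _ _ => c) = c := by
  rw [avg_y hμ P (fun _ => c)]
  simp_rw [← Finset.sum_mul, mutProb_sum hn, one_mul]
  exact inv_mul_card hμ c

lemma avg_point {n μ : ℕ} (hμ : 1 ≤ μ) (P : Fin μ → BitString n) (a : BitString n) (c : ℝ≥0∞) :
    avg P (fun y _ => if y = a then c else 0) = ∑ i : Fin μ, (μ : ℝ≥0∞)⁻¹ * (mutProb n (P i) a * c) := by
  rw [avg_y hμ P (fun y => if y = a then c else 0)]
  simp

lemma avg_point_le {n μ : ℕ} (hμ : 1 ≤ μ) (P : Fin μ → BitString n) (a : BitString n) (p : ℝ≥0∞)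
    (h : ∀ i, mutProb n (P i) a ≤ p) :
    avg P (fun y _ => if y = a then 1 else 0) ≤ p := by
  rw [avg_point hμ]
  calc _ ≤ ∑ _i : Fin μ, (μ : ℝ≥0∞)⁻¹ * p := by
        gcongr with i; simpa using h i
    _ = p := inv_mul_card hμ p

lemma avg_point_ge {n μ : ℕ} (hn : 2 ≤ n) (hμ : 1 ≤ μ) (P : Fin μ → BitString n)
    (a : BitString n) (c : ℝ≥0∞) (k : ℕ) (hk : k ≤ (Finset.univ.filter fun i => P i = a).card) :
    k * ((μ : ℝ≥0∞)⁻¹ * (4⁻¹ * c)) ≤ avg P (fun y _ => if y = a then c else 0) := by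
  rw [avg_point hμ]
  calc _ ≤ ((Finset.univ.filter fun i => P i = a).card : ℝ≥0∞) * ((μ : ℝ≥0∞)⁻¹ * (4⁻¹ * c)) := by
        gcongr
    _ = ∑ i ∈ Finset.univ.filter fun i => P i = a, ((μ : ℝ≥0∞)⁻¹ * (4⁻¹ * c)) := by
        rw [Finset.sum_const, nsmul_eq_mul]
    _ ≤ ∑ i ∈ Finset.univ.filter fun i => P i = a, (μ : ℝ≥0∞)⁻¹ * (mutProb n (P i) a * c) := by
        refine Finset.sum_le_sum fun i hi => ?_
        simp only [Finset.mem_filter, Finset.mem_univ, true_and] at hi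
        rw [hi]
        gcongr
        exact mutProb_self hn a
    _ ≤ _ := Finset.sum_le_sum_of_subset (Finset.filter_subset _ _)

lemma onesCount_le {n : ℕ} (x : BitString n) : onesCount x ≤ n := by
  unfold onesCount
  simpa using Finset.card_filter_le (Finset.univ : Finset (Fin n)) (fun i => x i = true)

lemma twoMax_le {n : ℕ} (x : BitString n) : twoMax x ≤ n := by
  have := onesCount_le x
  unfold twoMax; omega

lemma twoMax_zeros (n : ℕ) : twoMax (allZeros n) = n := by
  simp [twoMax, onesCount, allZeros]

lemma twoMax_ones (n : ℕ) : twoMax (allOnes n) = n := by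
  simp [twoMax, onesCount, allOnes]

lemma twoMax_opt {n : ℕ} {x : BitString n} (h : twoMax x = n) :
    x = allZeros n ∨ x = allOnes n := by
  have h1 := onesCount_le x
  have h2 : onesCount x = n ∨ onesCount x = 0 := by
    unfold twoMax at h; omega
  rcases h2 with h2 | h2
  · right
    unfold onesCount at h2
    have : (Finset.univ.filter fun i => x i = true) = Finset.univ := by
      apply Finset.eq_univ_of_card; simpa using h2
    funext i
    have : i ∈ (Finset.univ.filter fun i => x i = true) := by rw [this]; simp
    simpa [allOnes] using this
  · left
    unfold onesCount at h2
    rw [Finset.card_eq_zero] at h2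
    funext i
    have : i ∉ (Finset.univ.filter fun i => x i = true) := by rw [h2]; simp
    simpa [allZeros] using this

/-- number of optimal individuals -/
def cnt {n μ : ℕ} (P : Fin μ → BitString n) : ℕ :=
  (Finset.univ.filter fun i => twoMax (P i) = n).card

lemma cnt_le {n μ : ℕ} (P : Fin μ → BitString n) : cnt P ≤ μ := by
  unfold cnt
  simpa using Finset.card_filter_le (Finset.univ : Finset (Fin μ)) (fun i => twoMax (P i) = n)

lemma cnt_full {n μ : ℕ} {P : Fin μ → BitString n} (h : μ ≤ cnt P) (i : Fin μ) :
    twoMax (P i) = n := by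
  have : (Finset.univ.filter fun i => twoMax (P i) = n) = Finset.univ := by
    apply Finset.eq_univ_of_card
    have := cnt_le P
    unfold cnt at *
    simp; omega
  have : i ∈ (Finset.univ.filter fun i => twoMax (P i) = n) := by rw [this]; simp
  simpa using this

lemma cnt_next {n μ : ℕ} (s : State n μ) (y : BitString n) (j : Fin μ) :
    cnt s.1 ≤ cnt (nextS s y j).1 := by
  unfold cnt
  apply Finset.card_le_card
  intro i hi
  simp only [Finset.mem_filter, Finset.mem_univ, true_and] at hi ⊢
  simp only [nextS]
  split_ifs with h
  · by_cases hij : i = j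
    · subst hij
      have := twoMax_le y
      simp; omega
    · simp [hij, hi]
  · exact hi

lemma cnt_next_opt {n μ : ℕ} (s : State n μ) (y : BitString n) (j : Fin μ)
    (hy : twoMax y = n) : 1 ≤ cnt (nextS s y j).1 := by
  unfold cnt
  rw [Nat.one_le_iff_ne_zero, ← Nat.pos_iff_ne_zero, Finset.card_pos]
  refine ⟨j, ?_⟩
  have := twoMax_le (s.1 j)
  simp [nextS, hy, this]

lemma cnt_next_succ {n μ : ℕ} (s : State n μ) (y : BitString n) (j : Fin μ)
    (hj : j ∈ worstIdx twoMax s.1) (hc : cnt s.1 < μ)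
    (hy : twoMax y = n) : cnt s.1 + 1 ≤ cnt (nextS s y j).1 := by
  have hjn : twoMax (s.1 j) ≠ n := by
    intro h
    simp only [worstIdx, Finset.mem_filter, Finset.mem_univ, true_and, h] at hj
    have : ∀ i, twoMax (s.1 i) = n := fun i => le_antisymm (twoMax_le _) (hj i)
    have : cnt s.1 = μ := by simp [cnt, this]
    omega
  have hjm : j ∉ (Finset.univ.filter fun i => twoMax (s.1 i) = n) := by simpa using hjn
  unfold cnt
  rw [← Finset.card_insert_of_notMem hjm]
  apply Finset.card_le_card
  intro i hi
  have := twoMax_le (s.1 j)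
  simp only [Finset.mem_insert, Finset.mem_filter, Finset.mem_univ, true_and] at hi ⊢
  simp only [nextS]
  rw [if_pos (by omega)]
  by_cases hij : i = j
  · subst hij; simpa using hy
  · simp only [hij, false_or] at hi
    simp [hij, hi]

def dl (n μ k : ℕ) : ℝ≥0∞ := ENNReal.ofReal (4 * μ / (n * k))

def HH (n μ c : ℕ) : ℝ≥0∞ := ∑ k ∈ Finset.Ico c μ, dl n μ k

lemma HH_anti (n μ : ℕ) {c d : ℕ} (h : c ≤ d) : HH n μ d ≤ HH n μ c :=
  Finset.sum_le_sum_of_subset (Finset.Ico_subset_Ico_left h)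

lemma HH_succ (n μ : ℕ) {c : ℕ} (h : c < μ) : HH n μ c = dl n μ c + HH n μ (c + 1) :=
  Finset.sum_eq_sum_Ico_succ_bot h _

def Inv {n μ : ℕ} (s : State n μ) : Prop :=
  (s.2.1 = false → ∀ i, s.1 i ≠ allZeros n) ∧ (s.2.2 = false → ∀ i, s.1 i ≠ allOnes n) ∧
  (s.2.1 = true ∨ s.2.2 = true → 1 ≤ cnt s.1)

lemma Inv_next {n μ : ℕ} {s : State n μ} (h : Inv s) (y : BitString n) (j : Fin μ) :
    Inv (nextS s y j) := by
  obtain ⟨h1, h2, h3⟩ := h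
  refine ⟨?_, ?_, ?_⟩
  · intro hf i
    simp only [nextS, Bool.or_eq_false_iff, decide_eq_false_iff_not] at hf ⊢
    split_ifs
    · by_cases hij : i = j
      · subst hij; simpa using hf.2
      · simpa [hij] using h1 hf.1 i
    · exact h1 hf.1 i
  · intro hf i
    simp only [nextS, Bool.or_eq_false_iff, decide_eq_false_iff_not] at hf ⊢
    split_ifs
    · by_cases hij : i = j
      · subst hij; simpa using hf.2
      · simpa [hij] using h2 hf.1 i
    · exact h2 hf.1 i
  · intro hf
    simp only [nextS, Bool.or_eq_true, decide_eq_true_eq] at hf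
    have := cnt_next s y j
    rcases hf with (hf | hf) | (hf | hf)
    · exact (h3 (Or.inl hf)).trans this
    · exact cnt_next_opt s y j (by rw [hf, twoMax_zeros])
    · exact (h3 (Or.inr hf)).trans this
    · exact cnt_next_opt s y j (by rw [hf, twoMax_ones])

def GG {n μ : ℕ} (s : State n μ) : ℝ≥0∞ :=
  if bothFound s then 1 else if Inv s then HH n μ (cnt s.1) else ⊤

/-- the drift step, once exactly one optimum `a` was found -/
lemma drift_one {n μ : ℕ} (hn : 2 ≤ n) (hμ : 1 ≤ μ) (s : State n μ) (a b : BitString n)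
    (hopp : ∀ i, a i ≠ b i) (ha : twoMax a = n)
    (hopt : ∀ x : BitString n, twoMax x = n → x = a ∨ x = b)
    (hb : ∀ i, s.1 i ≠ b) (hc : 1 ≤ cnt s.1) (F : BitString n → Fin μ → ℝ≥0∞)
    (hF1 : ∀ j, F b j = 1)
    (hF : ∀ y, y ≠ b → ∀ j, F y j = HH n μ (cnt (nextS s y j).1)) :
    avg s.1 F ≤ HH n μ (cnt s.1) + ((n : ℝ≥0∞) ^ n)⁻¹ := by
  have hab : a ≠ b := fun h => hopp ⟨0, by omega⟩ (congrFun h _)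
  by_cases hfull : μ ≤ cnt s.1
  · have hall : ∀ i, s.1 i = a := fun i =>
      (hopt _ (cnt_full hfull i)).resolve_right (hb i)
    calc avg s.1 F ≤ avg s.1 (fun y _ => HH n μ (cnt s.1) + if y = b then 1 else 0) := by
          apply avg_mono
          intro y j _
          by_cases hy : y = b
          · subst hy; rw [hF1]; simp
          · rw [hF y hy]; simpa [hy] using HH_anti n μ (cnt_next s y j)
      _ = HH n μ (cnt s.1) + avg s.1 (fun y _ => if y = b then 1 else 0) := by
          rw [avg_add, avg_const hn hμ]
      _ ≤ _ := by
          gcongr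
          apply avg_point_le hμ
          intro i
          rw [hall i, mutProb_opp hopp]
  · push Not at hfull
    have hcnt : cnt s.1 ≤ (Finset.univ.filter fun i => s.1 i = a).card := by
      unfold cnt
      apply Finset.card_le_card
      intro i hi
      simp only [Finset.mem_filter, Finset.mem_univ, true_and] at hi ⊢
      exact (hopt _ hi).resolve_right (hb i)
    set c := cnt s.1 with hcdef
    have hge := avg_point_ge hn hμ s.1 a (dl n μ c) c hcnt
    have hval : c * ((μ : ℝ≥0∞)⁻¹ * (4⁻¹ * dl n μ c)) = (n : ℝ≥0∞)⁻¹ := by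
      have hn0 : (0 : ℝ) < n := by exact_mod_cast (by omega : 0 < n)
      have hm0 : (0 : ℝ) < μ := by exact_mod_cast hμ
      have hc0 : (0 : ℝ) < c := by exact_mod_cast hc
      have e4 : (4 : ℝ≥0∞)⁻¹ = ENNReal.ofReal (4⁻¹) := by
        rw [ENNReal.ofReal_inv_of_pos (by norm_num)]; simp
      have em : (μ : ℝ≥0∞)⁻¹ = ENNReal.ofReal (μ : ℝ)⁻¹ := by
        rw [ENNReal.ofReal_inv_of_pos hm0]; simp
      have en : (n : ℝ≥0∞)⁻¹ = ENNReal.ofReal (n : ℝ)⁻¹ := by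
        rw [ENNReal.ofReal_inv_of_pos hn0]; simp
      have ec : (c : ℝ≥0∞) = ENNReal.ofReal (c : ℝ) := by simp
      rw [e4, em, en, ec, dl, ← ENNReal.ofReal_mul (by positivity),
        ← ENNReal.ofReal_mul (by positivity), ← ENNReal.ofReal_mul (by positivity)]
      congr 1
      field_simp
    rw [hval] at hge
    have hle : avg s.1 (fun y _ => if y = b then 1 else 0) ≤ (n : ℝ≥0∞)⁻¹ :=
      avg_point_le hμ s.1 b _ (fun i => mutProb_le hn (hb i))
    have hmain : avg s.1 F + avg s.1 (fun y _ => if y = a then dl n μ c else 0) ≤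
        HH n μ c + avg s.1 (fun y _ => if y = b then 1 else 0) := by
      rw [← avg_add, ← avg_const hn hμ s.1 (HH n μ c), ← avg_add]
      apply avg_mono
      intro y j hj
      by_cases hy : y = b
      · subst hy; rw [hF1]; simp [hab.symm]
      · rw [hF y hy]
        by_cases hya : y = a
        · subst hya
          have := HH_anti n μ (cnt_next_succ s y j hj hfull ha)
          rw [HH_succ n μ hfull]
          simp only [if_true, hy, if_false, add_zero]
          rw [add_comm]
          gcongr
        · simpa [hy, hya] using HH_anti n μ (cnt_next s y j)
    have h2 : avg s.1 F + (n : ℝ≥0∞)⁻¹ ≤ HH n μ c + (n : ℝ≥0∞)⁻¹ :=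
      (add_le_add le_rfl hge).trans (hmain.trans (add_le_add le_rfl hle))
    have h3 : avg s.1 F ≤ HH n μ c := by
      refine (ENNReal.add_le_add_iff_right ?_).1 h2
      simp; omega
    exact h3.trans le_self_add

lemma drift {n μ : ℕ} (hn : 2 ≤ n) (hμ : 1 ≤ μ) (s : State n μ) :
    ∑ s', trans n μ s s' * GG s' ≤ GG s + ((n : ℝ≥0∞) ^ n)⁻¹ := by
  rw [trans_avg]
  have hz1 : ∀ i, allZeros n i ≠ allOnes n i := by intro i; simp [allZeros, allOnes]
  have hne : allZeros n ≠ allOnes n := fun h => hz1 ⟨0, by omega⟩ (congrFun h _)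
  by_cases hbf : bothFound s
  · have h1 : ∀ y j, GG (nextS s y j) = 1 := by
      intro y j
      unfold GG
      rw [if_pos]
      simp [bothFound, nextS] at hbf ⊢
      simp [hbf]
    simp_rw [h1]
    rw [avg_const hn hμ]
    simp [GG, hbf]
  by_cases hI : Inv s
  swap
  · simp [GG, hbf, hI]
  have hG : GG s = HH n μ (cnt s.1) := by simp [GG, hbf, hI]
  rw [hG]
  obtain ⟨P, z, o⟩ := s
  cases z <;> cases o
  · -- none found
    calc _ ≤ avg P (fun _ _ => HH n μ (cnt P)) := by
          apply avg_mono
          intro y j _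
          have hnb : ¬ bothFound (nextS ((P, false, false) : State n μ) y j) := by
            simp only [bothFound, nextS, Bool.false_or, decide_eq_true_eq]
            rintro ⟨h1, h2⟩
            exact hne (h1.symm.trans h2)
          simp only [GG, hnb, Inv_next hI y j, if_true, if_false]
          exact HH_anti n μ (cnt_next ((P, false, false) : State n μ) y j)
      _ = HH n μ (cnt P) := avg_const hn hμ _ _
      _ ≤ _ := le_self_add
  · -- ones found
    refine drift_one hn hμ (P, false, true) (allOnes n) (allZeros n) (fun i => (hz1 i).symm)
      (twoMax_ones n) (fun x hx => (twoMax_opt hx).symm) (hI.1 rfl) (hI.2.2 (Or.inr rfl)) _ ?_ ?_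
    · intro j; simp [GG, bothFound, nextS]
    · intro y hy j
      have hnb : ¬ bothFound (nextS ((P, false, true) : State n μ) y j) := by
        simp [bothFound, nextS, hy]
      simp only [GG, hnb, Inv_next hI y j, if_true, if_false]
  · refine drift_one hn hμ (P, true, false) (allZeros n) (allOnes n) hz1
      (twoMax_zeros n) (fun x hx => (twoMax_opt hx)) (hI.2.1 rfl) (hI.2.2 (Or.inl rfl)) _ ?_ ?_
    · intro j; simp [GG, bothFound, nextS]
    · intro y hy j
      have hnb : ¬ bothFound (nextS ((P, true, false) : State n μ) y j) := by
        simp [bothFound, nextS, hy]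
      simp only [GG, hnb, Inv_next hI y j, if_true, if_false]
  · exact absurd ⟨rfl, rfl⟩ hbf

lemma init_sum {n μ : ℕ} (G : State n μ → ℝ≥0∞) :
    ∑ s, init n μ s * G s = ∑ P : Fin μ → BitString n, ((2 : ℝ≥0∞) ^ (n * μ))⁻¹ *
      G (P, decide (∃ i, P i = allZeros n), decide (∃ i, P i = allOnes n)) := by
  rw [Fintype.sum_prod_type]
  refine Finset.sum_congr rfl fun P _ => ?_
  rw [Finset.sum_eq_single (decide (∃ i, P i = allZeros n), decide (∃ i, P i = allOnes n))]
  · simp [init]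
  · intro b _ hb
    simp only [init]
    rw [if_neg, mul_zero, zero_mul]
    rintro ⟨h1, h2⟩
    exact hb (Prod.ext h1 h2)
  · simp

lemma pop_const {n μ : ℕ} (c : ℝ≥0∞) :
    ∑ _P : Fin μ → BitString n, ((2 : ℝ≥0∞) ^ (n * μ))⁻¹ * c = c := by
  rw [Finset.sum_const, nsmul_eq_mul, ← mul_assoc, Finset.card_univ]
  have : ((Fintype.card (Fin μ → BitString n) : ℕ) : ℝ≥0∞) = (2 : ℝ≥0∞) ^ (n * μ) := by
    simp [pow_mul]
  rw [this, ENNReal.mul_inv_cancel, one_mul]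
  · positivity
  · simp

lemma pop_point {n μ : ℕ} (i : Fin μ) (a : BitString n) :
    ∑ P : Fin μ → BitString n, ((2 : ℝ≥0∞) ^ (n * μ))⁻¹ * (if P i = a then 1 else 0) =
      ((2 : ℝ≥0∞) ^ n)⁻¹ := by
  have h1 : ∀ P : Fin μ → BitString n, ((2 : ℝ≥0∞) ^ (n * μ))⁻¹ * (if P i = a then 1 else 0) =
      ∏ k, ((2 : ℝ≥0∞) ^ n)⁻¹ * (if k = i then (if P k = a then 1 else 0) else 1) := by
    intro P
    rw [Finset.prod_mul_distrib, Finset.prod_ite_eq']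
    simp [pow_mul, ENNReal.inv_pow]
  simp_rw [h1]
  rw [← Fintype.prod_sum (fun k (x : BitString n) =>
    ((2 : ℝ≥0∞) ^ n)⁻¹ * (if k = i then (if x = a then 1 else 0) else 1))]
  have h2 : ∀ k, ∑ x : BitString n,
      ((2 : ℝ≥0∞) ^ n)⁻¹ * (if k = i then (if x = a then 1 else 0) else 1) =
      if k = i then ((2 : ℝ≥0∞) ^ n)⁻¹ else 1 := by
    intro k
    by_cases hk : k = i
    · simp [hk]
    · simp only [hk, if_false, mul_one]
      rw [Finset.sum_const, nsmul_eq_mul, Finset.card_univ]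
      have : ((Fintype.card (BitString n) : ℕ) : ℝ≥0∞) = (2 : ℝ≥0∞) ^ n := by simp
      rw [this, ENNReal.mul_inv_cancel]
      · positivity
      · simp
  simp_rw [h2]
  simp

lemma Inv_init {n μ : ℕ} (P : Fin μ → BitString n) :
    Inv ((P, decide (∃ i, P i = allZeros n), decide (∃ i, P i = allOnes n)) : State n μ) := by
  refine ⟨?_, ?_, ?_⟩
  · intro h i; simp at h; exact h i
  · intro h i; simp at h; exact h i
  · intro h
    simp only [decide_eq_true_eq] at h
    unfold cnt
    rw [Nat.one_le_iff_ne_zero, ← Nat.pos_iff_ne_zero, Finset.card_pos]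
    rcases h with ⟨i, hi⟩ | ⟨i, hi⟩
    · exact ⟨i, by simp [hi, twoMax_zeros]⟩
    · exact ⟨i, by simp [hi, twoMax_ones]⟩

lemma init_GG {n μ : ℕ} :
    ∑ s, init n μ s * GG s ≤ HH n μ 0 + μ * ((2 : ℝ≥0∞) ^ n)⁻¹ := by
  rw [init_sum]
  calc _ ≤ ∑ P : Fin μ → BitString n, ((2 : ℝ≥0∞) ^ (n * μ))⁻¹ *
        (HH n μ 0 + ∑ i, if P i = allZeros n then 1 else 0) := by
        gcongr with P
        unfold GG
        split_ifs with h1 h2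
        · have h := h1.1
          simp only [decide_eq_true_eq] at h
          obtain ⟨i, hi⟩ := h
          calc (1 : ℝ≥0∞) = if P i = allZeros n then 1 else 0 := by simp [hi]
            _ ≤ ∑ i, if P i = allZeros n then (1 : ℝ≥0∞) else 0 :=
              Finset.single_le_sum (f := fun i => if P i = allZeros n then (1 : ℝ≥0∞) else 0)
                (fun _ _ => by simp) (Finset.mem_univ i)
            _ ≤ _ := le_add_self
        · exact (HH_anti n μ (Nat.zero_le _)).trans le_self_add
        · exact absurd (Inv_init P) h2
    _ = HH n μ 0 + ∑ i : Fin μ, ∑ P : Fin μ → BitString n, ((2 : ℝ≥0∞) ^ (n * μ))⁻¹ *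
          (if P i = allZeros n then 1 else 0) := by
        simp_rw [mul_add, Finset.sum_add_distrib]
        rw [pop_const, Finset.sum_comm]
        simp_rw [Finset.mul_sum]
    _ = _ := by
        simp_rw [pop_point]
        simp

lemma evolve_exp {n μ : ℕ} (t : ℕ) (G : State n μ → ℝ≥0∞) :
    ∑ s, evolve (init n μ) (trans n μ) (t + 1) s * G s =
      ∑ s, evolve (init n μ) (trans n μ) t s * ∑ s', trans n μ s s' * G s' := by
  simp only [evolve, Finset.sum_mul, Finset.mul_sum]
  rw [Finset.sum_comm]
  simp only [mul_assoc]

lemma evolve_mass {n μ : ℕ} (hn : 2 ≤ n) (hμ : 1 ≤ μ) (t : ℕ) :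
    ∑ s, evolve (init n μ) (trans n μ) t s = 1 := by
  induction t with
  | zero =>
    have := init_sum (n := n) (μ := μ) (fun _ => 1)
    rw [pop_const] at this
    simpa [evolve] using this
  | succ t ih =>
    have := evolve_exp (n := n) (μ := μ) t (fun _ => 1)
    simp_rw [fun s => trans_avg (n := n) (μ := μ) s (fun _ => 1),
      fun s : State n μ => avg_const hn hμ s.1 1, mul_one, ih] at this
    exact this

lemma evolve_GG {n μ : ℕ} (hn : 2 ≤ n) (hμ : 1 ≤ μ) (t : ℕ) :
    ∑ s, evolve (init n μ) (trans n μ) t s * GG s ≤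
      HH n μ 0 + μ * ((2 : ℝ≥0∞) ^ n)⁻¹ + t * ((n : ℝ≥0∞) ^ n)⁻¹ := by
  induction t with
  | zero => simpa [evolve] using init_GG
  | succ t ih =>
    rw [evolve_exp]
    calc _ ≤ ∑ s, evolve (init n μ) (trans n μ) t s * (GG s + ((n : ℝ≥0∞) ^ n)⁻¹) := by
          gcongr with s; exact drift hn hμ s
      _ = ∑ s, evolve (init n μ) (trans n μ) t s * GG s + ((n : ℝ≥0∞) ^ n)⁻¹ := by
          simp_rw [mul_add, Finset.sum_add_distrib]
          rw [← Finset.sum_mul, evolve_mass hn hμ, one_mul]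
      _ ≤ _ := add_le_add ih le_rfl
      _ = _ := by push_cast; ring

lemma find_le {n μ : ℕ} (hn : 2 ≤ n) (hμ : 1 ≤ μ) (t : ℕ) :
    findBothProb n μ t ≤ HH n μ 0 + μ * ((2 : ℝ≥0∞) ^ n)⁻¹ + t * ((n : ℝ≥0∞) ^ n)⁻¹ := by
  refine le_trans ?_ (evolve_GG hn hμ t)
  unfold findBothProb probOf
  gcongr with s
  split_ifs with h
  · simp [GG, h]
  · simp

lemma find_compl {n μ : ℕ} (hn : 2 ≤ n) (hμ : 1 ≤ μ) (t : ℕ) :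
    findBothProb n μ t + probOf (evolve (init n μ) (trans n μ) t) (fun s => ¬ bothFound s) = 1 := by
  rw [← evolve_mass hn hμ t]
  unfold findBothProb probOf
  rw [← Finset.sum_add_distrib]
  refine Finset.sum_congr rfl fun s _ => ?_
  by_cases h : bothFound s <;> simp [h]

lemma HH_le (n μ : ℕ) (hμ : 1 ≤ μ) :
    HH n μ 0 ≤ ENNReal.ofReal (4 * μ / n * (1 + Real.log μ)) := by
  unfold HH dl
  rw [← ENNReal.ofReal_sum_of_nonneg (fun _ _ => by positivity)]
  apply ENNReal.ofReal_le_ofReal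
  have h1 := harmonic_le_one_add_log μ
  have h2 : ∑ k ∈ Finset.Ico 0 μ, (4 * μ / (n * k) : ℝ) =
      4 * μ / n * ∑ k ∈ Finset.range μ, ((k : ℝ))⁻¹ := by
    rw [Finset.mul_sum, Finset.range_eq_Ico]
    refine Finset.sum_congr rfl fun k _ => ?_
    rw [div_mul_eq_div_div, div_eq_mul_inv _ (k : ℝ)]
  rw [h2]
  gcongr
  refine le_trans ?_ h1
  unfold harmonic
  obtain ⟨m, rfl⟩ : ∃ m, μ = m + 1 := ⟨μ - 1, by omega⟩
  rw [Finset.sum_range_succ']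
  push_cast
  rw [Finset.sum_range_succ]
  simp only [inv_zero, add_zero]
  have : (0 : ℝ) ≤ ((m : ℝ) + 1)⁻¹ := by positivity
  linarith

lemma eps_tendsto (μ : ℕ → ℕ) (hμ1 : ∀ n, 1 ≤ μ n)
    (hμ : (fun n => (μ n : ℝ)) =o[atTop] fun n => (n : ℝ) / Real.log n) :
    Tendsto (fun n => HH n (μ n) 0 + μ n * ((2 : ℝ≥0∞) ^ n)⁻¹) atTop (nhds 0) := by
  have hr : Tendsto (fun n : ℕ => (μ n : ℝ) / ((n : ℝ) / Real.log n)) atTop (nhds 0) :=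
    hμ.tendsto_div_nhds_zero
  have hup : Tendsto (fun n : ℕ => ENNReal.ofReal (9 * ((μ n : ℝ) / ((n : ℝ) / Real.log n))))
      atTop (nhds 0) := by
    have := ENNReal.tendsto_ofReal (hr.const_mul 9)
    simpa using this
  have hlog : ∀ᶠ n : ℕ in atTop, 1 ≤ Real.log n :=
    (Real.tendsto_log_atTop.comp tendsto_natCast_atTop_atTop).eventually_ge_atTop 1
  have hle1 : ∀ᶠ n : ℕ in atTop, (μ n : ℝ) / ((n : ℝ) / Real.log n) ≤ 1 :=
    hr.eventually (Iic_mem_nhds (by norm_num))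
  refine tendsto_of_tendsto_of_tendsto_of_le_of_le' tendsto_const_nhds hup
    (Eventually.of_forall fun _ => by simp) ?_
  filter_upwards [hlog, hle1, eventually_ge_atTop 1] with n h1 h2 h3
  have hn0 : (0 : ℝ) < n := by exact_mod_cast h3
  have hm0 : (1 : ℝ) ≤ μ n := by exact_mod_cast hμ1 n
  rw [div_le_one (by positivity)] at h2
  have hmn : (μ n : ℝ) ≤ n := h2.trans (div_le_self hn0.le h1)
  have hll : Real.log (μ n) ≤ Real.log n := Real.log_le_log (by linarith) hmn
  have hpow : (n : ℝ) ≤ 2 ^ n := by exact_mod_cast Nat.lt_two_pow_self.le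
  have e2 : (μ n : ℝ≥0∞) * ((2 : ℝ≥0∞) ^ n)⁻¹ = ENNReal.ofReal (μ n * ((2 : ℝ) ^ n)⁻¹) := by
    rw [ENNReal.ofReal_mul (by positivity), ENNReal.ofReal_inv_of_pos (by positivity),
      ENNReal.ofReal_pow (by norm_num)]
    simp
  calc _ ≤ ENNReal.ofReal (4 * μ n / n * (1 + Real.log (μ n))) +
        ENNReal.ofReal (μ n * ((2 : ℝ) ^ n)⁻¹) := by
        rw [e2]; gcongr; exact HH_le n (μ n) (hμ1 n)
    _ = ENNReal.ofReal (4 * μ n / n * (1 + Real.log (μ n)) + μ n * ((2 : ℝ) ^ n)⁻¹) := by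
        rw [ENNReal.ofReal_add _ (by positivity)]
        have := Real.log_nonneg hm0
        positivity
    _ ≤ _ := by
        apply ENNReal.ofReal_le_ofReal
        calc _ ≤ 4 * μ n / n * (Real.log n + Real.log n) + μ n * ((n : ℝ))⁻¹ * Real.log n := by
              have : (μ n : ℝ) * ((2 : ℝ) ^ n)⁻¹ ≤ μ n * ((n : ℝ))⁻¹ * Real.log n := by
                calc _ ≤ (μ n : ℝ) * ((n : ℝ))⁻¹ := by gcongr
                  _ ≤ _ := le_mul_of_one_le_right (by positivity) h1
              gcongr
          _ = _ := by
              have : Real.log n ≠ 0 := by linarith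
              field_simp
              ring

/-- adapted from Theorem 1 in Friedrich–Oliveto–Sudholt–Witt:
for every population size μ = μ(n) ≥ 1 with μ = o(n / log n), the probability that the
(μ+1) EA on TwoMax creates both optima within n^(n-1) generations tends to 0, and the
expected number of generations until both optima have been created is Ω(n^n). -/
theorem muPlusOneEA_TwoMax_no_mechanism
    (μ : ℕ → ℕ) (hμ1 : ∀ n, 1 ≤ μ n)
    (hμ : (fun n => (μ n : ℝ)) =o[atTop] fun n => (n : ℝ) / Real.log n) :
    Tendsto (fun n => findBothProb n (μ n) (n ^ (n - 1))) atTop (nhds 0) ∧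
    ∃ c : ℝ, 0 < c ∧ ∀ᶠ n : ℕ in atTop,
      ENNReal.ofReal (c * (n : ℝ) ^ n) ≤ expFindBoth n (μ n) := by
  have heps := eps_tendsto μ hμ1 hμ
  constructor
  · have hinv : Tendsto (fun n : ℕ => ((n : ℝ≥0∞))⁻¹) atTop (nhds 0) :=
      ENNReal.tendsto_inv_nat_nhds_zero
    have hsum := heps.add hinv
    rw [add_zero] at hsum
    refine tendsto_of_tendsto_of_tendsto_of_le_of_le' tendsto_const_nhds hsum
      (Eventually.of_forall fun _ => by simp) ?_
    filter_upwards [eventually_ge_atTop 2] with n hn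
    refine (find_le hn (hμ1 n) _).trans (add_le_add le_rfl ?_)
    apply le_of_eq
    obtain ⟨m, rfl⟩ : ∃ m, n = m + 1 := ⟨n - 1, by omega⟩
    have h0 : (((m + 1 : ℕ) : ℝ≥0∞)) ≠ 0 := by exact_mod_cast (by omega : m + 1 ≠ 0)
    rw [Nat.add_sub_cancel, Nat.cast_pow, pow_succ,
      ENNReal.mul_inv (Or.inr (by simp)) (Or.inr h0), ← mul_assoc,
      ENNReal.mul_inv_cancel (pow_ne_zero _ h0) (by simp), one_mul]
  · refine ⟨1 / 16, by norm_num, ?_⟩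
    have hev := heps.eventually (Iic_mem_nhds (show (0 : ℝ≥0∞) < 4⁻¹ by simp))
    filter_upwards [hev, eventually_ge_atTop 2] with n he hn
    have he' : HH n (μ n) 0 + μ n * ((2 : ℝ≥0∞) ^ n)⁻¹ ≤ 4⁻¹ := he
    have hnn : (n : ℝ≥0∞) ^ n ≠ 0 := pow_ne_zero _ (by exact_mod_cast (by omega : n ≠ 0))
    have hT : ∀ T ∈ Finset.range (n ^ n / 2),
        (4 : ℝ≥0∞)⁻¹ ≤ probOf (evolve (init n (μ n)) (trans n (μ n)) T) fun s => ¬ bothFound s := by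
      intro T hT
      rw [Finset.mem_range] at hT
      have h2T : ((2 * T : ℕ) : ℝ≥0∞) ≤ (n : ℝ≥0∞) ^ n := by
        have : 2 * T ≤ n ^ n := by omega
        exact_mod_cast this
      have hTn : (T : ℝ≥0∞) * ((n : ℝ≥0∞) ^ n)⁻¹ ≤ 2⁻¹ := by
        rw [← div_eq_mul_inv]
        apply ENNReal.div_le_of_le_mul
        rw [mul_comm, ← div_eq_mul_inv, ENNReal.le_div_iff_mul_le (by simp) (by simp)]
        push_cast at h2T
        rwa [mul_comm]
      have hf := find_le hn (hμ1 n) T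
      have hc := find_compl hn (hμ1 n) T
      have hf' : findBothProb n (μ n) T ≤ 4⁻¹ + 2⁻¹ := hf.trans (add_le_add he' hTn)
      have e1 : (4 : ℝ≥0∞)⁻¹ + 2⁻¹ + 4⁻¹ = 1 := by
        have : (2 : ℝ≥0∞)⁻¹ = 4⁻¹ + 4⁻¹ := by
          have h4 : (4 : ℝ≥0∞)⁻¹ = 2⁻¹ / 2 := by
            rw [div_eq_mul_inv, ← ENNReal.mul_inv (by simp) (by simp)]; norm_num
          rw [h4, ENNReal.add_halves]
        rw [add_right_comm, ← this, ENNReal.inv_two_add_inv_two]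
      have h3 : (4 : ℝ≥0∞)⁻¹ + 2⁻¹ + 4⁻¹ ≤ 4⁻¹ + 2⁻¹ +
          probOf (evolve (init n (μ n)) (trans n (μ n)) T) fun s => ¬ bothFound s := by
        rw [e1, ← hc]; gcongr
      refine (ENNReal.add_le_add_iff_left ?_).1 h3
      simp
    calc ENNReal.ofReal (1 / 16 * (n : ℝ) ^ n) ≤ ((n ^ n / 2 : ℕ) : ℝ≥0∞) * 4⁻¹ := by
          have e4 : (4 : ℝ≥0∞)⁻¹ = ENNReal.ofReal (4⁻¹) := by
            rw [ENNReal.ofReal_inv_of_pos (by norm_num)]; simp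
          rw [e4, ← ENNReal.ofReal_natCast, ← ENNReal.ofReal_mul (by positivity)]
          apply ENNReal.ofReal_le_ofReal
          have h4 : 4 ≤ n ^ n := by
            calc 4 = 2 ^ 2 := by norm_num
              _ ≤ n ^ 2 := Nat.pow_le_pow_left hn 2
              _ ≤ n ^ n := Nat.pow_le_pow_right (by omega) hn
          have h5 : n ^ n ≤ 4 * (n ^ n / 2) := by omega
          have h6 : ((n : ℝ)) ^ n ≤ 4 * ((n ^ n / 2 : ℕ) : ℝ) := by exact_mod_cast h5
          linarith
      _ = ∑ _T ∈ Finset.range (n ^ n / 2), (4 : ℝ≥0∞)⁻¹ := by simp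
      _ ≤ ∑ T ∈ Finset.range (n ^ n / 2),
          probOf (evolve (init n (μ n)) (trans n (μ n)) T) fun s => ¬ bothFound s :=
          Finset.sum_le_sum hT
      _ ≤ _ := ENNReal.sum_le_tsum _

end Stmt0
end
end

section
/- For every polynomially bounded population size function µ = µ(n) ≤ n^{O(1)}, there is a constant c > 0 such that the probability that the (µ+1) EA with fitness diversity run on TwoMax finds both optima within 2^{cn} generations tends to 0 as n → ∞, and the expected number of generations until both optima are found is 2^{Ω(n)}. Here 'finding both optima' means that at some time the union of the current population and the newly created offspring contains both 0^n and 1^n. -/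
open Filter
open scoped ENNReal BigOperators Classical

noncomputable section

namespace Stmt2

/-- State of a run: the current population, together with two flags recording whether
the all-zeros string resp. the all-ones string has already been created
(as an initial population member or as an offspring). -/
abbrev State (n μ : ℕ) := (Fin μ → BitString n) × Bool × Bool

/-- indices of population members of worst fitness -/
def worstIdx {n μ : ℕ} (f : BitString n → ℕ) (P : Fin μ → BitString n) : Finset (Fin μ) :=
  Finset.univ.filter fun j => ∀ i, f (P j) ≤ f (P i)

/-- One generation of the (μ+1) EA with fitness diversity on TwoMax: choose a parent
uniformly at random and mutate it, obtaining `y`; if some population member has the same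
fitness as `y`, then `y` replaces such a member (chosen uniformly at random among them);
otherwise an individual of worst fitness, chosen uniformly at random, is replaced
by `y` if `y` is at least as fit. -/
def trans (n μ : ℕ) : State n μ → State n μ → ℝ≥0∞ := fun s s' =>
  ∑ i : Fin μ, (μ : ℝ≥0∞)⁻¹ * ∑ y : BitString n, mutProb n (s.1 i) y *
    (let E : Finset (Fin μ) := Finset.univ.filter fun j => twoMax (s.1 j) = twoMax y
     let flagsOK : Prop :=
       s'.2.1 = (s.2.1 || decide (y = allZeros n)) ∧ s'.2.2 = (s.2.2 || decide (y = allOnes n))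
     if E.Nonempty then
       ∑ j ∈ E, (E.card : ℝ≥0∞)⁻¹ *
         (if s'.1 = Function.update s.1 j y ∧ flagsOK then 1 else 0)
     else
       ∑ j ∈ worstIdx twoMax s.1, ((worstIdx twoMax s.1).card : ℝ≥0∞)⁻¹ *
         (if s'.1 = (if twoMax (s.1 j) ≤ twoMax y then Function.update s.1 j y else s.1) ∧
             flagsOK then 1 else 0))

/-- Initialization: uniform over all populations of μ bit strings of length n;
the flags record whether an optimum is already present initially. -/
def init (n μ : ℕ) : State n μ → ℝ≥0∞ := fun s =>
  ((2 : ℝ≥0∞) ^ (n * μ))⁻¹ *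
    (if s.2.1 = decide (∃ i, s.1 i = allZeros n) ∧ s.2.2 = decide (∃ i, s.1 i = allOnes n)
      then 1 else 0)

/-- both optima have been created, i.e. at some point the union of the population and
the newly created offspring contained both optima -/
def bothFound {n μ : ℕ} (s : State n μ) : Prop := s.2.1 = true ∧ s.2.2 = true

/-- probability that both optima of TwoMax have been created within `T` generations -/
def findBothProb (n μ T : ℕ) : ℝ≥0∞ :=
  probOf (evolve (init n μ) (trans n μ) T) bothFound

/-- expected number of generations until both optima of TwoMax have been created -/
def expFindBoth (n μ : ℕ) : ℝ≥0∞ :=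
  ∑' T : ℕ, probOf (evolve (init n μ) (trans n μ) T) fun s => ¬ bothFound s


/-! ### Helper material -/

def dd {n : ℕ} (b : Bool) (x : BitString n) : ℕ := (Finset.univ.filter fun i => x i ≠ b).card

def lev {n : ℕ} (x : BitString n) : ℕ := n - twoMax x

lemma dd_add {n : ℕ} (b : Bool) (x : BitString n) : dd b x + dd (!b) x = n := by
  have h := Finset.card_filter_add_card_filter_not (s := (Finset.univ : Finset (Fin n)))
    (fun i => x i ≠ b)
  simp only [Finset.card_univ, Fintype.card_fin] at h
  refine Eq.trans ?_ h
  unfold dd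
  congr 2
  ext i
  simp only [Finset.mem_filter, Finset.mem_univ, true_and]
  cases x i <;> cases b <;> simp

lemma onesCount_eq {n : ℕ} (x : BitString n) : onesCount x = dd false x := by
  unfold onesCount dd
  congr 1
  ext i
  simp

lemma lev_eq {n : ℕ} (b : Bool) (x : BitString n) : lev x = min (dd b x) (dd (!b) x) := by
  have h := dd_add false x
  unfold lev twoMax
  rw [onesCount_eq]
  cases b <;> simp at * <;> omega

lemma twoMax_le {n : ℕ} (x : BitString n) : twoMax x ≤ n := by
  have h := dd_add false x
  unfold twoMax
  rw [onesCount_eq]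
  omega

lemma twoMax_add_lev {n : ℕ} (x : BitString n) : twoMax x + lev x = n := by
  have h := twoMax_le x
  unfold lev; omega

lemma dd_eq_zero {n : ℕ} (b : Bool) (x : BitString n) : dd b x = 0 ↔ x = fun _ => b := by
  unfold dd
  rw [Finset.card_eq_zero, Finset.filter_eq_empty_iff]
  constructor
  · intro h; ext i; simpa using h (Finset.mem_univ i)
  · rintro rfl; simp

section Pot
variable {n μ : ℕ}

def Valid (P : Fin μ → BitString n) (y : BitString n) (j : Fin μ) : Prop :=
  lev (P j) = lev y ∨ ((∀ i, lev (P i) ≠ lev y) ∧ ∀ i, lev (P i) ≤ lev (P j))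

def nextP (P : Fin μ → BitString n) (y : BitString n) (j : Fin μ) : Fin μ → BitString n :=
  if lev y ≤ lev (P j) then Function.update P j y else P

def AA (k : ℕ) (b : Bool) (P : Fin μ → BitString n) : ℕ :=
  Nat.findGreatest (fun a => ∀ i, a ≤ dd b (P i)) k

lemma le_AA_iff (k : ℕ) (b : Bool) (P : Fin μ → BitString n) (a : ℕ) :
    a ≤ AA k b P ↔ a ≤ k ∧ ∀ i, a ≤ dd b (P i) := by
  constructor
  · intro h
    refine ⟨h.trans (Nat.findGreatest_le k), fun i => h.trans ?_⟩
    exact Nat.findGreatest_spec (P := fun a => ∀ i, a ≤ dd b (P i)) (m := 0) (Nat.zero_le k)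
      (fun i => Nat.zero_le _) i
  · rintro ⟨h1, h2⟩
    exact Nat.le_findGreatest h1 h2

def XX (k : ℕ) (P : Fin μ → BitString n) : ℕ := max (AA k false P) (AA k true P)

lemma AA_le_XX (k : ℕ) (b : Bool) (P : Fin μ → BitString n) : AA k b P ≤ XX k P := by
  cases b
  · exact le_max_left _ _
  · exact le_max_right _ _

lemma exists_trail (k : ℕ) (P : Fin μ → BitString n) : ∃ t, AA k t P = XX k P := by
  unfold XX
  rcases le_total (AA k false P) (AA k true P) with h | h
  · exact ⟨true, by simp [h]⟩
  · exact ⟨false, by simp [h]⟩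

def NN (x : ℕ) (P : Fin μ → BitString n) : ℕ :=
  ((Finset.range x).filter fun l => ∃ i, lev (P i) = l).card

def Ph (k : ℕ) (P : Fin μ → BitString n) : ℕ := XX k P + NN (XX k P) P

lemma NN_le (x : ℕ) (P : Fin μ → BitString n) : NN x P ≤ x := by
  unfold NN
  exact (Finset.card_filter_le _ _).trans (by simp)

lemma NN_mono {x x' : ℕ} (h : x ≤ x') (P : Fin μ → BitString n) : NN x P ≤ NN x' P := by
  unfold NN
  apply Finset.card_le_card
  intro l
  simp only [Finset.mem_filter, Finset.mem_range]
  rintro ⟨h1, h2⟩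
  exact ⟨by omega, h2⟩

lemma NN_lip (x x' : ℕ) (P : Fin μ → BitString n) : NN x P ≤ NN x' P + (x - x') := by
  unfold NN
  have : ((Finset.range x).filter fun l => ∃ i, lev (P i) = l) ⊆
      ((Finset.range x').filter fun l => ∃ i, lev (P i) = l) ∪ Finset.Ico x' x := by
    intro l
    simp only [Finset.mem_filter, Finset.mem_range, Finset.mem_union, Finset.mem_Ico]
    rintro ⟨h1, h2⟩
    by_cases h : l < x'
    · exact Or.inl ⟨h, h2⟩
    · exact Or.inr ⟨by omega, h1⟩
  refine (Finset.card_le_card this).trans ((Finset.card_union_le _ _).trans ?_)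
  simp

lemma NN_step (x : ℕ) (P : Fin μ → BitString n) (y : BitString n) (j : Fin μ)
    (hv : Valid P y j) : NN x P ≤ NN x (nextP P y j) := by
  unfold nextP
  split_ifs with hle
  swap
  · exact le_rfl
  by_cases hx : x ≤ lev y ∨ lev (P j) = lev y
  · unfold NN
    apply Finset.card_le_card
    intro l
    simp only [Finset.mem_filter, Finset.mem_range]
    rintro ⟨h1, i, rfl⟩
    refine ⟨h1, i, ?_⟩
    by_cases hij : i = j
    · subst hij
      rcases hx with hx | hx
      · omega
      · simp [hx]
    · simp [Function.update_of_ne hij]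
  · push Not at hx
    rcases hv with hv | ⟨hv, -⟩
    · exact absurd hv hx.2
    unfold NN
    set F := (Finset.range x).filter fun l => ∃ i, lev (P i) = l with hF
    have hy : lev y ∉ F.erase (lev (P j)) := by
      simp only [hF, Finset.mem_erase, Finset.mem_filter, not_and, not_exists]
      intro _ _ i; exact hv i
    have : insert (lev y) (F.erase (lev (P j))) ⊆
        (Finset.range x).filter fun l => ∃ i, lev (Function.update P j y i) = l := by
      intro l
      simp only [hF, Finset.mem_insert, Finset.mem_erase, Finset.mem_filter, Finset.mem_range]
      rintro (rfl | ⟨h1, h2, i, rfl⟩)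
      · exact ⟨hx.1, j, by simp⟩
      · refine ⟨h2, i, ?_⟩
        rw [Function.update_of_ne]
        rintro rfl; exact h1 rfl
    have h2 := Finset.card_le_card this
    rw [Finset.card_insert_of_notMem hy] at h2
    have h3 := Finset.pred_card_le_card_erase (s := F) (a := lev (P j))
    omega

lemma nextP_cases (P : Fin μ → BitString n) (y : BitString n) (j i : Fin μ) :
    nextP P y j i = P i ∨ nextP P y j i = y := by
  unfold nextP
  split_ifs
  · by_cases h : i = j
    · right; subst h; simp
    · left; simp [Function.update_of_ne h]
  · left; rfl

lemma XX_step (k : ℕ) (P : Fin μ → BitString n) (t : Bool) (ht : AA k t P = XX k P)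
    (y : BitString n) (j : Fin μ) :
    XX k P - (XX k P - dd t y) ≤ XX k (nextP P y j) := by
  refine le_trans ?_ (AA_le_XX k t _)
  obtain ⟨h1, h2⟩ := (le_AA_iff k t P (XX k P)).1 ht.ge
  rw [le_AA_iff]
  refine ⟨by omega, fun i => ?_⟩
  rcases nextP_cases P y j i with h | h <;> rw [h]
  · have := h2 i; omega
  · omega

lemma Ph_of_XX (k : ℕ) (P : Fin μ → BitString n) (y : BitString n) (j : Fin μ)
    (hv : Valid P y j) (m : ℕ) (h : XX k P - m ≤ XX k (nextP P y j)) :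
    Ph k P ≤ Ph k (nextP P y j) + 2 * m := by
  unfold Ph
  have h1 := NN_step (XX k (nextP P y j)) P y j hv
  have h2 := NN_lip (XX k P) (XX k (nextP P y j)) P
  omega

lemma Ph_step (k : ℕ) (P : Fin μ → BitString n) (t : Bool) (ht : AA k t P = XX k P)
    (y : BitString n) (j : Fin μ) (hv : Valid P y j) :
    Ph k P ≤ Ph k (nextP P y j) + 2 * (XX k P - dd t y) :=
  Ph_of_XX k P y j hv _ (XX_step k P t ht y j)

def Uniq (k : ℕ) (P : Fin μ → BitString n) : Prop :=
  ∀ i j, i ≠ j → lev (P i) = lev (P j) → 2 * k ≤ lev (P i)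

lemma Uniq_step (k : ℕ) (P : Fin μ → BitString n) (hP : Uniq k P) (y : BitString n) (j : Fin μ)
    (hv : Valid P y j) : Uniq k (nextP P y j) := by
  unfold nextP
  split_ifs with hle
  swap
  · exact hP
  have key : ∀ i, i ≠ j → lev (P i) = lev y → 2 * k ≤ lev y := by
    intro i hij h
    rcases hv with hv | ⟨hv, -⟩
    · have := hP i j hij (h.trans hv.symm)
      omega
    · exact absurd h (hv i)
  intro a b hab h
  by_cases ha : a = j
  · subst ha
    rw [Function.update_of_ne (Ne.symm hab), Function.update_self] at h
    rw [Function.update_self]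
    exact key b (Ne.symm hab) h.symm
  · rw [Function.update_of_ne ha] at h ⊢
    by_cases hb : b = j
    · subst hb
      rw [Function.update_self] at h
      rw [h]; exact key a ha h
    · rw [Function.update_of_ne hb] at h
      exact hP a b hab h

/-- existence of a leading individual -/
lemma exists_lead (k : ℕ) (hk : 256 * k ≤ n) (P : Fin μ → BitString n) (hP : Uniq k P)
    (t : Bool) (ht : AA k t P = XX k P) (hX : XX k P < k) :
    ∃ i0, dd (!t) (P i0) < XX k P ∧
      (dd (!t) (P i0) + 1 < XX k P → ∀ i, lev (P i) ≠ dd (!t) (P i0) + 1) := by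
  obtain ⟨-, hXt⟩ := (le_AA_iff k t P (XX k P)).1 ht.ge
  obtain ⟨iX, hiX⟩ : ∃ i, dd t (P i) = XX k P := by
    by_contra hcon
    push Not at hcon
    have : XX k P + 1 ≤ AA k t P := by
      rw [le_AA_iff]
      refine ⟨hX, fun i => ?_⟩
      have := hXt i; have := hcon i; omega
    omega
  obtain ⟨i1, hi1⟩ : ∃ i, dd (!t) (P i) < XX k P := by
    by_contra hcon
    push Not at hcon
    have h1 : XX k P + 1 ≤ AA k (!t) P := by
      rw [le_AA_iff]
      refine ⟨hX, fun i => ?_⟩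
      have h2 := hcon i
      by_contra h3
      have h4 : dd (!t) (P i) = XX k P := by omega
      have hl1 := lev_eq t (P i)
      have hl2 := lev_eq t (P iX)
      have h5 := dd_add t (P i)
      have h6 := dd_add t (P iX)
      have hne : i ≠ iX := by rintro rfl; omega
      have := hP i iX hne (by omega)
      omega
    have := AA_le_XX k (!t) P
    omega
  -- take the maximal one
  let S : Finset (Fin μ) := Finset.univ.filter fun i => dd (!t) (P i) < XX k P
  obtain ⟨i0, hi0, hmax⟩ := Finset.exists_max_image S (fun i => dd (!t) (P i))
    ⟨i1, by simp [S, hi1]⟩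
  have hi0' : dd (!t) (P i0) < XX k P := by simpa [S] using hi0
  refine ⟨i0, hi0', fun hlt i hi => ?_⟩
  have h5 := dd_add t (P i)
  have hl1 := lev_eq t (P i)
  have h7 := hXt i
  have h8 : dd (!t) (P i) = dd (!t) (P i0) + 1 := by omega
  have := hmax i (by simp [S]; omega)
  omega

lemma Ph_good (k : ℕ) (hk : 256 * k ≤ n) (P : Fin μ → BitString n) (hP : Uniq k P)
    (t : Bool) (ht : AA k t P = XX k P) (hX : XX k P < k) (Z : ℕ) (hZ : Z < XX k P)
    (hZ' : Z + 1 < XX k P → ∀ i, lev (P i) ≠ Z + 1) (y : BitString n)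
    (hy : dd (!t) y = Z + 1) (j : Fin μ) (hv : Valid P y j) :
    Ph k P + 1 ≤ Ph k (nextP P y j) := by
  obtain ⟨-, hXt⟩ := (le_AA_iff k t P (XX k P)).1 ht.ge
  obtain ⟨iX, hiX⟩ : ∃ i, dd t (P i) = XX k P := by
    by_contra hcon
    push Not at hcon
    have : XX k P + 1 ≤ AA k t P := by
      rw [le_AA_iff]
      refine ⟨hX, fun i => ?_⟩
      have := hXt i; have := hcon i; omega
    omega
  have hyl : lev y = Z + 1 := by
    have := lev_eq t y; have := dd_add t y; omega
  have hyt := dd_add t y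
  have hXl : lev (P iX) = XX k P := by
    have := lev_eq t (P iX); have := dd_add t (P iX); omega
  have hXX := XX_step k P t ht y j
  have hXX' : XX k P ≤ XX k (nextP P y j) := by omega
  by_cases hlt : Z + 1 < XX k P
  · have hne := hZ' hlt
    have hj : XX k P ≤ lev (P j) := by
      rcases hv with hv | ⟨-, hv⟩
      · exact absurd (hv.trans hyl) (hne j)
      · have := hv iX; omega
    have hN : NN (XX k P) P + 1 ≤ NN (XX k P) (nextP P y j) := by
      unfold nextP
      rw [if_pos (by omega)]
      unfold NN
      rw [← Finset.card_insert_of_notMem (a := Z + 1)]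
      · apply Finset.card_le_card
        intro l
        simp only [Finset.mem_insert, Finset.mem_filter, Finset.mem_range]
        rintro (rfl | ⟨h1, i, rfl⟩)
        · exact ⟨hlt, j, by simp [hyl]⟩
        · refine ⟨h1, i, ?_⟩
          rw [Function.update_of_ne]
          rintro rfl; omega
      · simp only [Finset.mem_filter, not_and, not_exists]
        intro _ i; exact hne i
    have := NN_mono hXX' (nextP P y j)
    unfold Ph; omega
  · have hZX : Z + 1 = XX k P := by omega
    have hj : lev (P j) = lev y := by
      rcases hv with hv | ⟨hv, -⟩
      · exact hv
      · exact absurd (by omega) (hv iX)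
    have hjX : j = iX := by
      by_contra hne
      have := hP j iX hne (by omega)
      omega
    have h1 : XX k P + 1 ≤ XX k (nextP P y j) := by
      refine le_trans ?_ (AA_le_XX k t _)
      rw [le_AA_iff]
      refine ⟨hX, fun i => ?_⟩
      unfold nextP
      rw [if_pos (by omega)]
      by_cases hij : i = j
      · subst hij
        rw [Function.update_self]; omega
      · rw [Function.update_of_ne hij]
        have h3 := hXt i
        by_contra h4
        have h5 : dd t (P i) = XX k P := by omega
        have := lev_eq t (P i); have := dd_add t (P i)
        have := hP i iX (by rw [← hjX]; exact hij) (by omega)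
        omega
    have h2 := NN_step (XX k P) P y j hv
    have := NN_mono hXX' (nextP P y j)
    unfold Ph; omega

end Pot

section Kernel
variable {n μ : ℕ}

def nextS (s : State n μ) (y : BitString n) (j : Fin μ) : State n μ :=
  (nextP s.1 y j, (s.2.1 || decide (y = allZeros n)), (s.2.2 || decide (y = allOnes n)))

lemma sum_trans (s : State n μ) (V : State n μ → ℝ≥0∞) :
    ∑ s', trans n μ s s' * V s' =
    ∑ i : Fin μ, (μ : ℝ≥0∞)⁻¹ * ∑ y : BitString n, mutProb n (s.1 i) y *
      (if (Finset.univ.filter fun j => twoMax (s.1 j) = twoMax y).Nonempty then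
        ∑ j ∈ (Finset.univ.filter fun j => twoMax (s.1 j) = twoMax y),
          ((Finset.univ.filter fun j => twoMax (s.1 j) = twoMax y).card : ℝ≥0∞)⁻¹ *
            V (nextS s y j)
       else
        ∑ j ∈ worstIdx twoMax s.1, ((worstIdx twoMax s.1).card : ℝ≥0∞)⁻¹ * V (nextS s y j)) := by
  have hlev : ∀ (x y : BitString n), twoMax x ≤ twoMax y ↔ lev y ≤ lev x := by
    intro x y
    have := twoMax_add_lev x; have := twoMax_add_lev y; omega
  have key : ∀ (Q : Fin μ → BitString n) (y : BitString n) (c : ℝ≥0∞),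
      ∑ s' : State n μ, c * (if s'.1 = Q ∧ (s'.2.1 = (s.2.1 || decide (y = allZeros n)) ∧
        s'.2.2 = (s.2.2 || decide (y = allOnes n))) then 1 else 0) * V s' =
      c * V (Q, (s.2.1 || decide (y = allZeros n)), (s.2.2 || decide (y = allOnes n))) := by
    intro Q y c
    rw [Finset.sum_eq_single
      ((Q, (s.2.1 || decide (y = allZeros n)), (s.2.2 || decide (y = allOnes n))) : State n μ)]
    · simp
    · rintro ⟨a, b, c'⟩ - hne
      rw [if_neg]
      · simp
      · rintro ⟨h1, h2, h3⟩
        apply hne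
        simp only at h1 h2 h3
        rw [h1, h2, h3]
    · simp
  unfold trans
  simp only [Finset.sum_mul]
  rw [Finset.sum_comm]
  refine Finset.sum_congr rfl fun i _ => ?_
  simp only [mul_assoc, ← Finset.mul_sum, Finset.sum_mul]
  congr 1
  rw [Finset.sum_comm]
  refine Finset.sum_congr rfl fun y _ => ?_
  rw [← Finset.mul_sum]
  congr 1
  split_ifs with hE
  · simp only [Finset.mul_sum, Finset.sum_mul]
    rw [Finset.sum_comm]
    refine Finset.sum_congr rfl fun j hj => ?_
    rw [key]
    unfold nextS nextP
    simp only [Finset.mem_filter, Finset.mem_univ, true_and] at hj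
    rw [if_pos ((hlev _ _).1 hj.le)]
  · simp only [Finset.mul_sum, Finset.sum_mul]
    rw [Finset.sum_comm]
    refine Finset.sum_congr rfl fun j hj => ?_
    rw [key]
    unfold nextS nextP
    simp only [hlev]

lemma worst_nonempty (hμ : 1 ≤ μ) (P : Fin μ → BitString n) : (worstIdx twoMax P).Nonempty := by
  obtain ⟨j, -, hj⟩ := Finset.exists_min_image (Finset.univ : Finset (Fin μ))
    (fun i => twoMax (P i)) ⟨⟨0, hμ⟩, Finset.mem_univ _⟩
  exact ⟨j, by simpa [worstIdx] using hj⟩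

lemma avg_const {ι : Type*} (S : Finset ι) (h : S.Nonempty) (c : ℝ≥0∞) :
    ∑ _j ∈ S, (S.card : ℝ≥0∞)⁻¹ * c = c := by
  rw [Finset.sum_const, nsmul_eq_mul, ← mul_assoc, ENNReal.mul_inv_cancel, one_mul]
  · simpa using h.ne_empty
  · simp

lemma sum_trans_le (hμ : 1 ≤ μ) (s : State n μ) (V : State n μ → ℝ≥0∞)
    (U : Fin μ → BitString n → ℝ≥0∞)
    (hU : ∀ i y j, Valid s.1 y j → V (nextS s y j) ≤ U i y) :
    ∑ s', trans n μ s s' * V s' ≤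
      ∑ i : Fin μ, (μ : ℝ≥0∞)⁻¹ * ∑ y : BitString n, mutProb n (s.1 i) y * U i y := by
  rw [sum_trans]
  gcongr with i _ y _
  split_ifs with hE
  · calc _ ≤ ∑ j ∈ (Finset.univ.filter fun j => twoMax (s.1 j) = twoMax y),
          ((Finset.univ.filter fun j => twoMax (s.1 j) = twoMax y).card : ℝ≥0∞)⁻¹ * U i y := by
          gcongr with j hj
          apply hU
          left
          simp only [Finset.mem_filter, Finset.mem_univ, true_and] at hj
          unfold lev; omega
      _ = _ := avg_const _ hE _
  · calc _ ≤ ∑ j ∈ worstIdx twoMax s.1,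
          ((worstIdx twoMax s.1).card : ℝ≥0∞)⁻¹ * U i y := by
          gcongr with j hj
          apply hU
          right
          simp only [worstIdx, Finset.mem_filter, Finset.mem_univ, true_and] at hj
          rw [Finset.not_nonempty_iff_eq_empty, Finset.filter_eq_empty_iff] at hE
          refine ⟨fun l hl => hE (Finset.mem_univ l) ?_, fun l => ?_⟩
          · have := twoMax_add_lev (s.1 l); have := twoMax_add_lev y; omega
          · have := hj l; unfold lev; omega
      _ = _ := avg_const _ (worst_nonempty hμ _) _

/-! mutation -/

lemma mutProb_prod (x y : BitString n) :
    mutProb n x y = ∏ i, if x i ≠ y i then (n : ℝ≥0∞)⁻¹ else 1 - (n : ℝ≥0∞)⁻¹ := by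
  rw [Finset.prod_ite, Finset.prod_const, Finset.prod_const]
  unfold mutProb hammingDist
  congr 2
  have h := Finset.card_filter_add_card_filter_not (s := (Finset.univ : Finset (Fin n)))
    (fun i => x i ≠ y i)
  simp only [Finset.card_univ, Fintype.card_fin] at h
  omega

lemma sum_prod_bool (g : Fin n → Bool → ℝ≥0∞) :
    ∑ y : BitString n, ∏ i, g i (y i) = ∏ i, ∑ b, g i b := by
  rw [Finset.prod_univ_sum, Fintype.piFinset_univ]

lemma inv_add_sub (hn : 1 ≤ n) : (n : ℝ≥0∞)⁻¹ + (1 - (n : ℝ≥0∞)⁻¹) = 1 := by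
  apply add_tsub_cancel_of_le
  rw [ENNReal.inv_le_one]
  exact_mod_cast hn

lemma mutProb_sum (hn : 1 ≤ n) (x : BitString n) : ∑ y, mutProb n x y = 1 := by
  simp only [mutProb_prod]
  rw [sum_prod_bool (fun i b => if x i ≠ b then (n : ℝ≥0∞)⁻¹ else 1 - (n : ℝ≥0∞)⁻¹)]
  apply Finset.prod_eq_one
  intro i _
  rw [Fintype.sum_bool]
  have := inv_add_sub hn
  cases x i
  · simpa using this
  · simpa [add_comm] using this

def FF (t : Bool) (x y : BitString n) : ℕ :=
  (Finset.univ.filter fun i => x i ≠ t ∧ y i = t).card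

lemma dd_le_FF (t : Bool) (x y : BitString n) : dd t x ≤ dd t y + FF t x y := by
  unfold dd FF
  refine le_trans (Finset.card_le_card ?_) (Finset.card_union_le _ _)
  intro i
  simp only [Finset.mem_union, Finset.mem_filter, Finset.mem_univ, true_and]
  tauto

lemma mutProb_mgf (hn : 1 ≤ n) (t : Bool) (x : BitString n) (a : ℝ≥0∞) :
    ∑ y, mutProb n x y * a ^ FF t x y ≤ (1 + a * (n : ℝ≥0∞)⁻¹) ^ dd t x := by
  have h1 : ∀ y : BitString n, a ^ FF t x y = ∏ i, if x i ≠ t ∧ y i = t then a else 1 := by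
    intro y
    rw [Finset.prod_ite, Finset.prod_const, Finset.prod_const_one, mul_one]
    rfl
  simp only [mutProb_prod, h1, ← Finset.prod_mul_distrib]
  rw [sum_prod_bool (fun i b => (if x i ≠ b then (n : ℝ≥0∞)⁻¹ else 1 - (n : ℝ≥0∞)⁻¹) *
    (if x i ≠ t ∧ b = t then a else 1))]
  have h2 : (1 + a * (n : ℝ≥0∞)⁻¹) ^ dd t x =
      ∏ i, if x i ≠ t then (1 + a * (n : ℝ≥0∞)⁻¹) else 1 := by
    rw [Finset.prod_ite, Finset.prod_const, Finset.prod_const_one, mul_one]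
    rfl
  rw [h2]
  refine Finset.prod_le_prod' fun i _ => ?_
  rw [Fintype.sum_bool]
  have h3 := inv_add_sub hn
  have h4 : 1 - (n : ℝ≥0∞)⁻¹ ≤ 1 := tsub_le_self
  cases hx : x i <;> cases t <;> simp
  · rw [h3]
  · rw [add_comm, mul_comm]; gcongr
  · rw [mul_comm]; gcongr
  · rw [add_comm, h3]

lemma mutProb_flip (x : BitString n) (i : Fin n) :
    mutProb n x (Function.update x i (!x i)) =
      (n : ℝ≥0∞)⁻¹ * (1 - (n : ℝ≥0∞)⁻¹) ^ (n - 1) := by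
  have : hammingDist x (Function.update x i (!x i)) = 1 := by
    unfold hammingDist
    rw [Finset.card_eq_one]
    refine ⟨i, ?_⟩
    ext l
    simp only [Finset.mem_filter, Finset.mem_univ, true_and, Finset.mem_singleton]
    by_cases h : l = i
    · subst h; simp
    · simp [Function.update_of_ne h, h]
  unfold mutProb
  rw [this, pow_one]

lemma dd_flip (b : Bool) (x : BitString n) (i : Fin n) (hi : x i = b) :
    dd b (Function.update x i (!x i)) = dd b x + 1 := by
  unfold dd
  rw [← Finset.card_insert_of_notMem (a := i)]
  · congr 1
    ext l
    simp only [Finset.mem_filter, Finset.mem_univ, true_and, Finset.mem_insert]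
    by_cases h : l = i
    · subst h; simp [hi]
    · simp [Function.update_of_ne h, h]
  · simp [hi]

lemma pow_lower (hn : 2 ≤ n) : ENNReal.ofReal (1/3) ≤ (1 - (n : ℝ≥0∞)⁻¹) ^ (n - 1) := by
  have h0 : (1 - (n : ℝ≥0∞)⁻¹) = ENNReal.ofReal (1 - (n : ℝ)⁻¹) := by
    rw [ENNReal.ofReal_sub _ (by positivity), ENNReal.ofReal_one,
      ENNReal.ofReal_inv_of_pos (by positivity), ENNReal.ofReal_natCast]
  obtain ⟨m, rfl⟩ : ∃ m, n = m + 2 := ⟨n - 2, by omega⟩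
  have hp : (0:ℝ) < 1 - ((m + 2 : ℕ) : ℝ)⁻¹ := by
    rw [sub_pos]; apply inv_lt_one_of_one_lt₀; push_cast; linarith [Nat.cast_nonneg (α := ℝ) m]
  rw [h0, ← ENNReal.ofReal_pow hp.le]
  apply ENNReal.ofReal_le_ofReal
  have h1 : (1 - ((m + 2 : ℕ) : ℝ)⁻¹) = (1 + ((m:ℝ)+1)⁻¹)⁻¹ := by
    have : (0:ℝ) < m + 1 := by positivity
    push_cast; field_simp; ring
  rw [h1, inv_pow, show m + 2 - 1 = m + 1 from rfl, one_div]
  apply inv_anti₀ (by positivity)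
  have h2 : (1 + ((m:ℝ)+1)⁻¹) ≤ Real.exp (((m:ℝ)+1)⁻¹) := by
    have := Real.add_one_le_exp (((m:ℝ)+1)⁻¹); linarith
  calc (1 + ((m:ℝ)+1)⁻¹) ^ (m+1) ≤ (Real.exp (((m:ℝ)+1)⁻¹)) ^ (m+1) := by gcongr
    _ = Real.exp 1 := by
      rw [← Real.exp_nat_mul]; congr 1; push_cast; field_simp
    _ ≤ 3 := by linarith [Real.exp_one_lt_d9]

lemma mutProb_good (hn : 2 ≤ n) (b : Bool) (x : BitString n) (hx : 4 * dd b x ≤ n) :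
    (4 : ℝ≥0∞)⁻¹ ≤ ∑ y, mutProb n x y * (if dd b y = dd b x + 1 then 1 else 0) := by
  let S : Finset (Fin n) := Finset.univ.filter fun i => ¬ (x i ≠ b)
  have hS : 3 * n ≤ 4 * S.card := by
    have h := Finset.card_filter_add_card_filter_not (s := (Finset.univ : Finset (Fin n)))
      (fun i => x i ≠ b)
    simp only [Finset.card_univ, Fintype.card_fin] at h
    change dd b x + S.card = n at h
    omega
  have hinj : Set.InjOn (fun i => Function.update x i (!x i)) (S : Set (Fin n)) := by
    intro i _ l _ h
    by_contra hne
    have := congrFun h i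
    simp [Function.update_of_ne hne] at this
  calc (4 : ℝ≥0∞)⁻¹ ≤ (S.card : ℝ≥0∞) * ((n : ℝ≥0∞)⁻¹ * (1 - (n : ℝ≥0∞)⁻¹) ^ (n - 1)) := by
        have h3 : (4 : ℝ≥0∞)⁻¹ = ENNReal.ofReal (3/4) * ENNReal.ofReal (1/3) := by
          rw [← ENNReal.ofReal_mul (by norm_num)]
          rw [← ENNReal.ofReal_ofNat, ← ENNReal.ofReal_inv_of_pos (by norm_num)]
          norm_num
        rw [h3, ← mul_assoc]
        refine mul_le_mul' ?_ (pow_lower hn)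
        have hn0 : (0:ℝ) < n := by positivity
        rw [← ENNReal.ofReal_natCast, ← ENNReal.ofReal_natCast,
          ← ENNReal.ofReal_inv_of_pos hn0, ← ENNReal.ofReal_mul (by positivity)]
        apply ENNReal.ofReal_le_ofReal
        rw [← div_eq_mul_inv, le_div_iff₀ hn0]
        have : (3 * n : ℝ) ≤ 4 * S.card := by exact_mod_cast hS
        linarith
    _ = ∑ i ∈ S, mutProb n x (Function.update x i (!x i)) := by
        simp only [mutProb_flip]
        rw [Finset.sum_const, nsmul_eq_mul]
    _ = ∑ y ∈ S.image (fun i => Function.update x i (!x i)), mutProb n x y := by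
        rw [Finset.sum_image hinj]
    _ = ∑ y ∈ S.image (fun i => Function.update x i (!x i)),
          mutProb n x y * (if dd b y = dd b x + 1 then 1 else 0) := by
        refine Finset.sum_congr rfl fun y hy => ?_
        obtain ⟨i, hi, rfl⟩ := Finset.mem_image.1 hy
        rw [if_pos, mul_one]
        apply dd_flip
        simpa [S] using hi
    _ ≤ _ := Finset.sum_le_sum_of_subset (Finset.subset_univ _)

end Kernel

section Drift
variable {n μ : ℕ}

lemma base_le (hn : 1 ≤ n) (z : ℕ) (r : ℝ) (h : 128 * (z : ℝ) ≤ r * n) :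
    (1 + 128 * (n : ℝ≥0∞)⁻¹) ^ z ≤ ENNReal.ofReal (Real.exp r) := by
  have hn0 : (0:ℝ) < n := by exact_mod_cast hn
  have h0 : (1 + 128 * (n : ℝ≥0∞)⁻¹) = ENNReal.ofReal (1 + 128 * (n:ℝ)⁻¹) := by
    rw [ENNReal.ofReal_add (by norm_num) (by positivity), ENNReal.ofReal_one,
      ENNReal.ofReal_mul (by norm_num), ENNReal.ofReal_inv_of_pos hn0, ENNReal.ofReal_natCast]
    simp
  rw [h0, ← ENNReal.ofReal_pow (by positivity)]
  apply ENNReal.ofReal_le_ofReal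
  calc (1 + 128 * (n:ℝ)⁻¹) ^ z ≤ (Real.exp (128 * (n:ℝ)⁻¹)) ^ z := by
        gcongr
        have := Real.add_one_le_exp (128 * (n:ℝ)⁻¹); linarith
    _ = Real.exp (z * (128 * (n:ℝ)⁻¹)) := by rw [← Real.exp_nat_mul]
    _ ≤ Real.exp r := by
        apply Real.exp_le_exp.2
        rw [← div_eq_mul_inv, ← mul_div_assoc, div_le_iff₀ hn0]
        linarith

/-- penalty weight -/
def pen (X d : ℕ) : ℝ≥0∞ := if d < X then 4 ^ (X - d) else 0

lemma pen_le (t : Bool) (X : ℕ) (x y : BitString n) (hx : X ≤ dd t x) :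
    pen X (dd t y) ≤ (32 : ℝ≥0∞)⁻¹ * ((128 : ℝ≥0∞)⁻¹) ^ (dd t x - X) * 128 ^ FF t x y := by
  unfold pen
  split_ifs with h
  swap
  · exact zero_le
  have h1 := dd_le_FF t x y
  obtain ⟨D, hD⟩ : ∃ D, dd t x = X + D := ⟨dd t x - X, by omega⟩
  obtain ⟨m, hm⟩ : ∃ m, X = dd t y + (m + 1) := ⟨X - dd t y - 1, by omega⟩
  have e1 : dd t x - X = D := by omega
  have e2 : X - dd t y = m + 1 := by omega
  rw [e1, e2]
  have h3 : D + (m + 1) ≤ FF t x y := by omega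
  calc (4 : ℝ≥0∞) ^ (m + 1) ≤ (32 : ℝ≥0∞)⁻¹ * 128 ^ (m + 1) := by
        rw [show (128 : ℝ≥0∞) = 32 * 4 by norm_num, mul_pow, pow_succ (32 : ℝ≥0∞),
          mul_comm ((32 : ℝ≥0∞) ^ m) 32, mul_assoc, ← mul_assoc (32 : ℝ≥0∞)⁻¹,
          ENNReal.inv_mul_cancel (by norm_num) (by norm_num), one_mul]
        exact le_mul_of_one_le_left zero_le (one_le_pow₀ (by norm_num))
    _ = (32 : ℝ≥0∞)⁻¹ * ((128 : ℝ≥0∞)⁻¹) ^ D * 128 ^ (D + (m + 1)) := by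
        rw [pow_add (128 : ℝ≥0∞) D, mul_assoc, ← mul_assoc ((128 : ℝ≥0∞)⁻¹ ^ D), ← mul_pow,
          ENNReal.inv_mul_cancel (by norm_num) (by norm_num), one_pow, one_mul]
    _ ≤ _ := by
        gcongr
        norm_num

def CC : ℝ≥0∞ := ENNReal.ofReal (Real.exp 128)

lemma pen_sum (hn : 1 ≤ n) (t : Bool) (X : ℕ) (x : BitString n) (hx : X ≤ dd t x) :
    ∑ y, mutProb n x y * pen X (dd t y) ≤
      (32 : ℝ≥0∞)⁻¹ * ((128 : ℝ≥0∞)⁻¹) ^ (dd t x - X) * (1 + 128 * (n : ℝ≥0∞)⁻¹) ^ dd t x := by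
  calc _ ≤ ∑ y, mutProb n x y *
        ((32 : ℝ≥0∞)⁻¹ * ((128 : ℝ≥0∞)⁻¹) ^ (dd t x - X) * 128 ^ FF t x y) := by
        gcongr with y _
        exact pen_le t X x y hx
    _ = (32 : ℝ≥0∞)⁻¹ * ((128 : ℝ≥0∞)⁻¹) ^ (dd t x - X) *
        ∑ y, mutProb n x y * 128 ^ FF t x y := by
        rw [Finset.mul_sum]
        refine Finset.sum_congr rfl fun y _ => ?_
        ring
    _ ≤ _ := by gcongr; exact mutProb_mgf hn t x 128

lemma dd_le (t : Bool) (x : BitString n) : dd t x ≤ n := by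
  have := dd_add t x; omega

lemma half_anti {a b : ℕ} (h : a ≤ b) : (2⁻¹ : ℝ≥0∞) ^ b ≤ (2⁻¹) ^ a :=
  pow_le_pow_right_of_le_one' (by rw [ENNReal.inv_le_one]; norm_num) h

lemma inv32_le : (32 : ℝ≥0∞)⁻¹ ≤ 1 := by
  rw [ENNReal.inv_le_one]; norm_num

lemma inv128_le : (128 : ℝ≥0∞)⁻¹ ≤ 2⁻¹ := by
  apply ENNReal.inv_le_inv.2; norm_num

lemma pen_sum_far (hn : 1 ≤ n) (t : Bool) (X k : ℕ) (x : BitString n) (hx : X + k ≤ dd t x) :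
    ∑ y, mutProb n x y * pen X (dd t y) ≤ CC * (2⁻¹) ^ k := by
  refine (pen_sum hn t X x (by omega)).trans ?_
  have h1 := base_le hn (dd t x) 128 (by
    have : (dd t x : ℝ) ≤ n := by exact_mod_cast dd_le t x
    linarith)
  have h2 : ((128 : ℝ≥0∞)⁻¹) ^ (dd t x - X) ≤ (2⁻¹) ^ k :=
    calc ((128 : ℝ≥0∞)⁻¹) ^ (dd t x - X) ≤ (2⁻¹) ^ (dd t x - X) := by
          exact pow_le_pow_left' inv128_le _
      _ ≤ _ := half_anti (by omega)
  calc _ ≤ 1 * (2⁻¹) ^ k * CC := mul_le_mul' (mul_le_mul' inv32_le h2) h1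
    _ = _ := by ring

lemma pen_sum_near (hn : 1 ≤ n) (t : Bool) (X : ℕ) (x : BitString n) (hx : X ≤ dd t x)
    (hx2 : 128 * dd t x ≤ n) :
    ∑ y, mutProb n x y * pen X (dd t y) ≤
      (32 : ℝ≥0∞)⁻¹ * 3 * ((128 : ℝ≥0∞)⁻¹) ^ (dd t x - X) := by
  refine (pen_sum hn t X x hx).trans ?_
  have h1 : (1 + 128 * (n : ℝ≥0∞)⁻¹) ^ dd t x ≤ 3 := by
    refine (base_le hn (dd t x) 1 (by rw [one_mul]; exact_mod_cast hx2)).trans ?_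
    rw [← ENNReal.ofReal_ofNat]
    apply ENNReal.ofReal_le_ofReal
    linarith [Real.exp_one_lt_d9]
  calc _ ≤ (32 : ℝ≥0∞)⁻¹ * ((128 : ℝ≥0∞)⁻¹) ^ (dd t x - X) * 3 := by gcongr
    _ = _ := by ring

lemma geom_bound : (32 : ℝ≥0∞)⁻¹ * 3 * (1 - (128 : ℝ≥0∞)⁻¹)⁻¹ ≤ 8⁻¹ := by
  have e : (1 - (128 : ℝ≥0∞)⁻¹) = ENNReal.ofReal (127/128) := by
    rw [show (127/128 : ℝ) = 1 - 128⁻¹ by norm_num, ENNReal.ofReal_sub _ (by norm_num),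
      ENNReal.ofReal_one, ENNReal.ofReal_inv_of_pos (by norm_num), ENNReal.ofReal_ofNat]
  rw [e, ← ENNReal.ofReal_inv_of_pos (by norm_num), ← ENNReal.ofReal_ofNat 32,
    ← ENNReal.ofReal_ofNat 3, ← ENNReal.ofReal_ofNat 8, ← ENNReal.ofReal_inv_of_pos (by norm_num),
    ← ENNReal.ofReal_inv_of_pos (by norm_num), ← ENNReal.ofReal_mul (by norm_num),
    ← ENNReal.ofReal_mul (by norm_num)]
  apply ENNReal.ofReal_le_ofReal
  norm_num

lemma pen_total (hn : 1 ≤ n) (k : ℕ) (hk : 256 * k ≤ n) (P : Fin μ → BitString n)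
    (hP : Uniq k P) (t : Bool) (X : ℕ) (hX : X ≤ k) (hXt : ∀ i, X ≤ dd t (P i)) :
    ∑ i, ∑ y, mutProb n (P i) y * pen X (dd t y) ≤ 8⁻¹ + μ * (CC * (2⁻¹) ^ k) := by
  rw [← Finset.sum_filter_add_sum_filter_not Finset.univ (fun i => dd t (P i) < 2 * k)]
  refine add_le_add ?_ ?_
  · calc _ ≤ ∑ i ∈ Finset.univ.filter (fun i => dd t (P i) < 2 * k),
          (32 : ℝ≥0∞)⁻¹ * 3 * ((128 : ℝ≥0∞)⁻¹) ^ (dd t (P i) - X) := by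
          refine Finset.sum_le_sum fun i hi => ?_
          simp only [Finset.mem_filter, Finset.mem_univ, true_and] at hi
          exact pen_sum_near hn t X (P i) (hXt i) (by omega)
      _ = (32 : ℝ≥0∞)⁻¹ * 3 * ∑ i ∈ Finset.univ.filter (fun i => dd t (P i) < 2 * k),
           ((128 : ℝ≥0∞)⁻¹) ^ (dd t (P i) - X) := by rw [Finset.mul_sum]
      _ = (32 : ℝ≥0∞)⁻¹ * 3 * ∑ D ∈ (Finset.univ.filter (fun i => dd t (P i) < 2 * k)).image
           (fun i => dd t (P i) - X), ((128 : ℝ≥0∞)⁻¹) ^ D := by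
          rw [Finset.sum_image]
          intro a ha b hb hab
          simp only [Finset.coe_filter, Finset.mem_univ, true_and, Set.mem_ofPred_eq] at ha hb hab
          by_contra hne
          have h1 := hXt a; have h2 := hXt b
          have h3 := lev_eq t (P a); have h4 := lev_eq t (P b)
          have h5 := dd_add t (P a); have h6 := dd_add t (P b)
          have := hP a b hne (by omega)
          omega
      _ ≤ (32 : ℝ≥0∞)⁻¹ * 3 * ∑' D, ((128 : ℝ≥0∞)⁻¹) ^ D := by
          gcongr; exact ENNReal.sum_le_tsum _
      _ ≤ 8⁻¹ := by rw [ENNReal.tsum_geometric]; exact geom_bound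
  · calc _ ≤ ∑ i ∈ Finset.univ.filter (fun i => ¬ dd t (P i) < 2 * k), CC * (2⁻¹) ^ k := by
          refine Finset.sum_le_sum fun i hi => ?_
          simp only [Finset.mem_filter, Finset.mem_univ, true_and] at hi
          exact pen_sum_far hn t X k (P i) (by omega)
      _ ≤ ∑ i : Fin μ, CC * (2⁻¹) ^ k := Finset.sum_le_sum_of_subset (Finset.subset_univ _)
      _ = _ := by simp

def Good (k : ℕ) (s : State n μ) : Prop :=
  Uniq k s.1 ∧ (s.2.1 = true → ∃ i, s.1 i = allZeros n) ∧ (s.2.2 = true → ∃ i, s.1 i = allOnes n)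

def VV (k : ℕ) (s : State n μ) : ℝ≥0∞ :=
  if bothFound s ∨ ¬ Good k s then 1 else (2⁻¹) ^ Ph k s.1

lemma VV_le_one (k : ℕ) (s : State n μ) : VV k s ≤ 1 := by
  unfold VV
  split_ifs
  · exact le_rfl
  · exact pow_le_one' (by rw [ENNReal.inv_le_one]; norm_num) _

lemma lev_zero_of (b : Bool) (x : BitString n) (h : x = fun _ => b) : lev x = 0 := by
  have := (dd_eq_zero b x).2 h
  have := lev_eq b x
  omega

lemma keep_opt (b : Bool) (P : Fin μ → BitString n) (y : BitString n)
    (j : Fin μ) (hv : Valid P y j) (h : ∃ i, P i = fun _ => b) (hy : y ≠ fun _ => !b) :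
    ∃ i, nextP P y j i = fun _ => b := by
  obtain ⟨i, hi⟩ := h
  unfold nextP
  split_ifs with hle
  swap
  · exact ⟨i, hi⟩
  by_cases hij : i = j
  · subst hij
    have h0 := lev_zero_of b _ hi
    have h1 : lev y = 0 := by omega
    refine ⟨i, ?_⟩
    rw [Function.update_self]
    have h2 := lev_eq b y
    have h3 : dd (!b) y ≠ 0 := fun h => hy ((dd_eq_zero _ _).1 h)
    exact (dd_eq_zero _ _).1 (by omega)
  · exact ⟨i, by rw [Function.update_of_ne hij, hi]⟩

lemma new_opt (b : Bool) (P : Fin μ → BitString n) (j : Fin μ) :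
    ∃ i, nextP P (fun _ => b) j i = fun _ => b := by
  refine ⟨j, ?_⟩
  unfold nextP
  rw [if_pos, Function.update_self]
  rw [lev_zero_of b _ rfl]; exact Nat.zero_le _

lemma Good_step (hn : 1 ≤ n) (k : ℕ) (s : State n μ) (hs : Good k s)
    (y : BitString n) (j : Fin μ) (hv : Valid s.1 y j) (hb' : ¬ bothFound (nextS s y j)) :
    Good k (nextS s y j) := by
  have hne : allZeros n ≠ allOnes n := by
    intro h; have := congrFun h ⟨0, hn⟩; simp [allZeros, allOnes] at this
  obtain ⟨h1, h2, h3⟩ := hs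
  refine ⟨Uniq_step k _ h1 y j hv, ?_, ?_⟩
  · intro hf
    simp only [nextS, Bool.or_eq_true, decide_eq_true_eq] at hf ⊢
    by_cases hy : y = allZeros n
    · subst hy; exact new_opt false _ _
    · refine keep_opt false s.1 y j hv (h2 (by tauto)) ?_
      intro hy'
      apply hb'
      simp only [bothFound, nextS, Bool.or_eq_true, decide_eq_true_eq]
      exact ⟨hf, Or.inr hy'⟩
  · intro hf
    simp only [nextS, Bool.or_eq_true, decide_eq_true_eq] at hf ⊢
    by_cases hy : y = allOnes n
    · subst hy; exact new_opt true _ _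
    · refine keep_opt true s.1 y j hv (h3 (by tauto)) ?_
      intro hy'
      apply hb'
      simp only [bothFound, nextS, Bool.or_eq_true, decide_eq_true_eq]
      exact ⟨Or.inr hy', hf⟩

lemma AA_zero (k : ℕ) (b : Bool) (P : Fin μ → BitString n) (h : ∃ i, P i = fun _ => b) :
    AA k b P = 0 := by
  obtain ⟨i, hi⟩ := h
  have h1 := ((le_AA_iff k b P _).1 le_rfl).2 i
  have h2 := (dd_eq_zero b _).2 hi
  omega

/-- if both optima are found in this step then the trailing side jumped to its optimum -/
lemma both_step (hn : 1 ≤ n) (k : ℕ) (s : State n μ) (hs : Good k s) (hb : ¬ bothFound s)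
    (t : Bool) (ht : AA k t s.1 = XX k s.1)
    (y : BitString n) (j : Fin μ) (hb' : bothFound (nextS s y j)) :
    XX k s.1 = 0 ∨ dd t y = 0 := by
  have hne : allZeros n ≠ allOnes n := by
    intro h; have := congrFun h ⟨0, hn⟩; simp [allZeros, allOnes] at this
  obtain ⟨h1, h2, h3⟩ := hs
  simp only [bothFound, nextS, Bool.or_eq_true, decide_eq_true_eq] at hb' hb
  obtain ⟨ha, hc⟩ := hb'
  have : ∃ b, (∃ i, s.1 i = fun _ => b) ∧ y = fun _ => !b := by
    by_cases hy : y = allZeros n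
    · have : s.2.2 = true := by
        rcases hc with hc | hc
        · exact hc
        · exact absurd (hy.symm.trans hc) hne
      exact ⟨true, h3 this, hy⟩
    · have hz : s.2.1 = true := by tauto
      have : y = allOnes n := by tauto
      exact ⟨false, h2 hz, this⟩
  obtain ⟨b, hb1, hb2⟩ := this
  by_cases htb : t = b
  · left
    rw [← ht, htb]; exact AA_zero k b _ hb1
  · right
    have : t = !b := by cases t <;> cases b <;> simp_all
    rw [this]
    exact (dd_eq_zero _ _).2 hb2

lemma half_pow_le (a b m : ℕ) (h : a ≤ b + 2 * m) :
    (2⁻¹ : ℝ≥0∞) ^ b ≤ (2⁻¹) ^ a * 4 ^ m := by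
  calc (2⁻¹ : ℝ≥0∞) ^ b = (2⁻¹) ^ (b + 2 * m) * 4 ^ m := by
        rw [show (4 : ℝ≥0∞) = 2 ^ 2 by norm_num, ← pow_mul, pow_add, mul_assoc, ← mul_pow,
          ENNReal.inv_mul_cancel (by norm_num) (by norm_num), one_pow, mul_one]
    _ ≤ _ := by
        gcongr ?_ * _
        exact half_anti h

lemma VV_step (hn : 1 ≤ n) (k : ℕ) (s : State n μ) (hs : Good k s) (hb : ¬ bothFound s)
    (t : Bool) (ht : AA k t s.1 = XX k s.1)
    (y : BitString n) (j : Fin μ) (hv : Valid s.1 y j) :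
    VV k (nextS s y j) ≤ (2⁻¹) ^ Ph k s.1 * 4 ^ (XX k s.1 - dd t y) := by
  by_cases hb' : bothFound (nextS s y j)
  · have h1 := both_step hn k s hs hb t ht y j hb'
    refine (VV_le_one k _).trans ?_
    rw [← pow_zero (2⁻¹ : ℝ≥0∞)]
    apply half_pow_le
    have := NN_le (XX k s.1) s.1
    unfold Ph
    omega
  · have hg := Good_step hn k s hs y j hv hb'
    unfold VV
    rw [if_neg (by tauto)]
    apply half_pow_le
    exact Ph_step k s.1 t ht y j hv

lemma pow4_le (X d : ℕ) : (4 : ℝ≥0∞) ^ (X - d) ≤ 1 + pen X d := by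
  unfold pen
  split_ifs with h
  · exact le_add_self
  · rw [Nat.sub_eq_zero_of_le (by omega)]; simp

lemma avg_one (hn : 1 ≤ n) (hμ : 1 ≤ μ) (P : Fin μ → BitString n) :
    ∑ i : Fin μ, (μ : ℝ≥0∞)⁻¹ * ∑ y, mutProb n (P i) y = 1 := by
  simp only [mutProb_sum hn, mul_one]
  rw [Finset.sum_const, Finset.card_univ, Fintype.card_fin, nsmul_eq_mul, ENNReal.mul_inv_cancel]
  · simp; omega
  · simp

lemma drift (hn : 2 ≤ n) (hμ : 1 ≤ μ) (k : ℕ) (hk : 256 * k ≤ n) (s : State n μ) 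
    (hsum : ∑ s', trans n μ s s' = 1) :
    ∑ s', trans n μ s s' * VV k s' ≤ VV k s + (1 + CC) * (2⁻¹) ^ k := by
  by_cases hbad : bothFound s ∨ ¬ Good k s
  · have : VV k s = 1 := by unfold VV; rw [if_pos hbad]
    rw [this]
    refine le_trans ?_ le_self_add
    rw [← hsum]
    gcongr with s' _
    exact mul_le_of_le_one_right zero_le (VV_le_one k s')
  have hb : ¬ bothFound s := by tauto
  have hs : Good k s := by tauto
  obtain ⟨t, ht⟩ := exists_trail k s.1
  obtain ⟨hXk, hXt⟩ := (le_AA_iff k t s.1 (XX k s.1)).1 ht.ge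
  have hV : VV k s = (2⁻¹) ^ Ph k s.1 := by unfold VV; rw [if_neg hbad]
  have hpen := pen_total (by omega) k hk s.1 hs.1 t (XX k s.1) hXk hXt
  have hμi : (μ : ℝ≥0∞)⁻¹ * μ = 1 :=
    ENNReal.inv_mul_cancel (by simp; omega) (by simp)
  have hμ1 : (μ : ℝ≥0∞)⁻¹ ≤ 1 := by rw [ENNReal.inv_le_one]; exact_mod_cast hμ
  have hsplit : ∑ i : Fin μ, (μ : ℝ≥0∞)⁻¹ * ∑ y, mutProb n (s.1 i) y *
      (1 + pen (XX k s.1) (dd t y)) ≤ 1 + ((μ : ℝ≥0∞)⁻¹ * 8⁻¹ + CC * (2⁻¹) ^ k) := by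
    simp only [mul_add, mul_one, Finset.sum_add_distrib]
    rw [avg_one (by omega) hμ]
    gcongr
    rw [← Finset.mul_sum]
    refine (mul_le_mul_right hpen _).trans ?_
    rw [mul_add, ← mul_assoc, hμi, one_mul]
  have h81 : (8 : ℝ≥0∞)⁻¹ ≤ 1 := by rw [ENNReal.inv_le_one]; norm_num
  have hV1 : VV k s ≤ 1 := VV_le_one k s
  by_cases hX : XX k s.1 < k
  · obtain ⟨i0, hi0, hi0'⟩ := exists_lead k hk s.1 hs.1 t ht hX
    -- indicator of the good event
    let g : Fin μ → BitString n → Prop := fun i y => i = i0 ∧ dd (!t) y = dd (!t) (s.1 i0) + 1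
    let w : Fin μ → BitString n → ℝ≥0∞ := fun i y =>
      if g i y then 2⁻¹ else 1 + pen (XX k s.1) (dd t y)
    have hstep : ∑ s', trans n μ s s' * VV k s' ≤ ∑ i : Fin μ, (μ : ℝ≥0∞)⁻¹ *
        ∑ y : BitString n, mutProb n (s.1 i) y * (VV k s * w i y) := by
      apply sum_trans_le hμ
      intro i y j hv
      by_cases hg : g i y
      · simp only [w, if_pos hg]
        have h1 := Ph_good k hk s.1 hs.1 t ht hX _ hi0 hi0' y hg.2 j hv
        have hb' : ¬ bothFound (nextS s y j) := by
          intro hb'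
          have h3 := both_step (by omega) k s hs hb t ht y j hb'
          have h4 := dd_add t y
          have h5 := hg.2
          omega
        have hgd := Good_step (by omega) k s hs y j hv hb'
        have : VV k (nextS s y j) = (2⁻¹) ^ Ph k (nextP s.1 y j) := by
          unfold VV; rw [if_neg (by tauto)]; rfl
        rw [this, hV, ← pow_succ]
        exact half_anti h1
      · simp only [w, if_neg hg]
        rw [hV]
        refine (VV_step (by omega) k s hs hb t ht y j hv).trans ?_
        gcongr
        exact pow4_le _ _
    have hgood : (μ : ℝ≥0∞)⁻¹ * 8⁻¹ ≤ ∑ i : Fin μ, (μ : ℝ≥0∞)⁻¹ *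
        ∑ y : BitString n, mutProb n (s.1 i) y * (2⁻¹ * if g i y then 1 else 0) := by
      refine le_trans ?_ (Finset.single_le_sum (fun _ _ => zero_le) (Finset.mem_univ i0))
      gcongr
      have h1 := mutProb_good hn (!t) (s.1 i0) (by omega)
      calc (8 : ℝ≥0∞)⁻¹ = 2⁻¹ * 4⁻¹ := by
            rw [← ENNReal.mul_inv (by norm_num) (by norm_num)]; norm_num
        _ ≤ 2⁻¹ * _ := mul_le_mul_right h1 _
        _ = _ := by
            rw [Finset.mul_sum]
            refine Finset.sum_congr rfl fun y _ => ?_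
            simp only [g, true_and]
            ring
    have hw : ∑ i : Fin μ, (μ : ℝ≥0∞)⁻¹ * ∑ y : BitString n, mutProb n (s.1 i) y * w i y ≤
        1 + CC * (2⁻¹) ^ k := by
      have hfin : (μ : ℝ≥0∞)⁻¹ * 8⁻¹ ≠ ⊤ :=
        ne_top_of_le_ne_top ENNReal.one_ne_top (mul_le_one' hμ1 h81)
      refine (ENNReal.add_le_add_iff_right hfin).1 ?_
      refine (add_le_add_right hgood _).trans ?_
      rw [← Finset.sum_add_distrib]
      simp only [← mul_add, ← Finset.sum_add_distrib]
      refine le_trans ?_ (hsplit.trans (le_of_eq (by ring)))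
      refine Finset.sum_le_sum fun i _ => mul_le_mul' le_rfl
        (Finset.sum_le_sum fun y _ => mul_le_mul' le_rfl ?_)
      simp only [w]
      split_ifs with hg
      · rw [mul_one, ENNReal.inv_two_add_inv_two]; exact le_self_add
      · simp
    refine hstep.trans ?_
    have : ∑ i : Fin μ, (μ : ℝ≥0∞)⁻¹ *
        ∑ y : BitString n, mutProb n (s.1 i) y * (VV k s * w i y) = VV k s *
        ∑ i : Fin μ, (μ : ℝ≥0∞)⁻¹ * ∑ y : BitString n, mutProb n (s.1 i) y * w i y := by
      simp only [Finset.mul_sum]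
      refine Finset.sum_congr rfl fun i _ => Finset.sum_congr rfl fun y _ => ?_
      ring
    rw [this]
    refine (mul_le_mul_right hw _).trans ?_
    rw [mul_add, mul_one]
    refine add_le_add le_rfl ?_
    refine (mul_le_of_le_one_left zero_le hV1).trans ?_
    gcongr
    exact le_add_self
  · have hXe : XX k s.1 = k := by omega
    have hVk : VV k s ≤ (2⁻¹) ^ k := by
      rw [hV]
      exact half_anti
        (by unfold Ph; omega)
    have hstep : ∑ s', trans n μ s s' * VV k s' ≤ ∑ i : Fin μ, (μ : ℝ≥0∞)⁻¹ *
        ∑ y : BitString n, mutProb n (s.1 i) y * (VV k s * (1 + pen (XX k s.1) (dd t y))) := by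
      apply sum_trans_le hμ
      intro i y j hv
      rw [hV]
      refine (VV_step (by omega) k s hs hb t ht y j hv).trans ?_
      gcongr
      exact pow4_le _ _
    refine hstep.trans ?_
    have : ∑ i : Fin μ, (μ : ℝ≥0∞)⁻¹ *
        ∑ y : BitString n, mutProb n (s.1 i) y * (VV k s * (1 + pen (XX k s.1) (dd t y))) =
        VV k s * ∑ i : Fin μ, (μ : ℝ≥0∞)⁻¹ *
        ∑ y : BitString n, mutProb n (s.1 i) y * (1 + pen (XX k s.1) (dd t y)) := by
      simp only [Finset.mul_sum]
      refine Finset.sum_congr rfl fun i _ => Finset.sum_congr rfl fun y _ => ?_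
      ring
    rw [this]
    refine (mul_le_mul_right hsplit _).trans ?_
    rw [mul_add, mul_one]
    refine add_le_add le_rfl ?_
    rw [mul_comm]
    refine mul_le_mul' ?_ hVk
    refine add_le_add (mul_le_one' hμ1 h81) ?_
    exact mul_le_of_le_one_right zero_le (pow_le_one' (by rw [ENNReal.inv_le_one]; norm_num) _)

end Drift

section Final
variable {n μ : ℕ}

lemma trans_sum (hn : 1 ≤ n) (hμ : 1 ≤ μ) (s : State n μ) : ∑ s', trans n μ s s' = 1 := by
  have h := sum_trans s (fun _ => 1)
  simp only [mul_one] at h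
  rw [h, ← avg_one hn hμ s.1]
  refine Finset.sum_congr rfl fun i _ => ?_
  congr 1
  refine Finset.sum_congr rfl fun y _ => ?_
  split_ifs with hE
  · have := avg_const _ hE 1
    simp only [mul_one] at this
    rw [this, mul_one]
  · have := avg_const _ (worst_nonempty hμ s.1) 1
    simp only [mul_one] at this
    rw [this, mul_one]

lemma init_sum (V : State n μ → ℝ≥0∞) :
    ∑ s, init n μ s * V s = ∑ P : Fin μ → BitString n, ((2 : ℝ≥0∞) ^ (n * μ))⁻¹ *
      V (P, decide (∃ i, P i = allZeros n), decide (∃ i, P i = allOnes n)) := by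
  rw [Fintype.sum_prod_type]
  refine Finset.sum_congr rfl fun P _ => ?_
  rw [Finset.sum_eq_single
    ((decide (∃ i, P i = allZeros n), decide (∃ i, P i = allOnes n)) : Bool × Bool)]
  · simp [init]
  · rintro ⟨a, b⟩ - hne
    unfold init
    rw [if_neg]
    · simp
    · rintro ⟨h1, h2⟩
      apply hne
      simp only at h1 h2
      rw [h1, h2]
  · simp

lemma pop_sum (h : Fin μ → BitString n → ℝ≥0∞) :
    ∑ P : Fin μ → BitString n, ((2 : ℝ≥0∞) ^ (n * μ))⁻¹ * ∏ l, h l (P l) =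
      ∏ l, ∑ x, ((2 : ℝ≥0∞) ^ n)⁻¹ * h l x := by
  rw [Finset.prod_univ_sum, Fintype.piFinset_univ]
  refine Finset.sum_congr rfl fun P _ => ?_
  rw [Finset.prod_mul_distrib, Finset.prod_const, Finset.card_univ, Fintype.card_fin,
    pow_mul, ENNReal.inv_pow]

lemma unif_sum : ∑ _x : BitString n, ((2 : ℝ≥0∞) ^ n)⁻¹ = 1 := by
  rw [Finset.sum_const, Finset.card_univ, nsmul_eq_mul]
  simp only [Fintype.card_pi, Fintype.card_bool, Finset.prod_const, Finset.card_univ,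
    Fintype.card_fin]
  push_cast
  apply ENNReal.mul_inv_cancel <;> simp

lemma pop_one : ∑ _P : Fin μ → BitString n, ((2 : ℝ≥0∞) ^ (n * μ))⁻¹ = 1 := by
  have := pop_sum (n := n) (μ := μ) (fun _ _ => 1)
  simp only [Finset.prod_const_one, mul_one, unif_sum] at this
  exact this

lemma pop_marginal (i : Fin μ) (f : BitString n → ℝ≥0∞) :
    ∑ P : Fin μ → BitString n, ((2 : ℝ≥0∞) ^ (n * μ))⁻¹ * f (P i) =
      ∑ x, ((2 : ℝ≥0∞) ^ n)⁻¹ * f x := by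
  have h := pop_sum (n := n) (μ := μ) (fun l x => if l = i then f x else 1)
  have h1 : ∀ P : Fin μ → BitString n, ∏ l, (if l = i then f (P l) else 1) = f (P i) := by
    intro P; simp
  simp only [h1] at h
  rw [h, Finset.prod_eq_single i]
  · simp
  · intro l _ hl
    simp only [if_neg hl, mul_one]
    exact unif_sum
  · simp

lemma tail_one (b : Bool) (k : ℕ) (hk : 256 * k ≤ n) :
    ∑ x : BitString n, ((2 : ℝ≥0∞) ^ n)⁻¹ * (if dd b x < 2 * k then 1 else 0) ≤ (2⁻¹) ^ k := by
  have h1 : ∀ x : BitString n, (2⁻¹ : ℝ≥0∞) ^ dd b x = ∏ i, if x i ≠ b then 2⁻¹ else 1 := by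
    intro x
    rw [Finset.prod_ite, Finset.prod_const, Finset.prod_const_one, mul_one]
    rfl
  have h2 : ∑ x : BitString n, ((2 : ℝ≥0∞) ^ n)⁻¹ * (2⁻¹) ^ dd b x =
      (ENNReal.ofReal (3/4)) ^ n := by
    have : ∀ x : BitString n, ((2 : ℝ≥0∞) ^ n)⁻¹ * (2⁻¹) ^ dd b x =
        ∏ i, (2⁻¹ * if x i ≠ b then 2⁻¹ else 1) := by
      intro x
      rw [Finset.prod_mul_distrib, ← h1, Finset.prod_const, Finset.card_univ, Fintype.card_fin,
        ENNReal.inv_pow]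
    simp only [this]
    rw [sum_prod_bool (fun _ c => 2⁻¹ * if c ≠ b then (2⁻¹ : ℝ≥0∞) else 1), Finset.prod_const,
      Finset.card_univ, Fintype.card_fin]
    congr 1
    rw [Fintype.sum_bool]
    have e : (2⁻¹ : ℝ≥0∞) = ENNReal.ofReal (1/2) := by
      rw [one_div, ENNReal.ofReal_inv_of_pos (by norm_num), ENNReal.ofReal_ofNat]
    rw [e]
    cases b
    · simp only [ne_eq, Bool.true_eq_false, not_false_eq_true, if_true, not_true_eq_false, if_false,
        mul_one]
      rw [← ENNReal.ofReal_mul (by norm_num), ← ENNReal.ofReal_add (by norm_num) (by norm_num)]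
      norm_num
    · simp only [ne_eq, Bool.false_eq_true, not_false_eq_true, if_true, not_true_eq_false, if_false,
        mul_one]
      rw [← ENNReal.ofReal_mul (by norm_num), ← ENNReal.ofReal_add (by norm_num) (by norm_num)]
      norm_num
  calc _ ≤ ∑ x : BitString n, ((2 : ℝ≥0∞) ^ n)⁻¹ * (4 ^ k * (2⁻¹) ^ dd b x) := by
        refine Finset.sum_le_sum fun x _ => mul_le_mul' le_rfl ?_
        split_ifs with h
        · rw [mul_comm]
          have := half_pow_le (dd b x) 0 k (by omega)
          simpa using this
        · exact zero_le
    _ = 4 ^ k * ∑ x : BitString n, ((2 : ℝ≥0∞) ^ n)⁻¹ * (2⁻¹) ^ dd b x := by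
        rw [Finset.mul_sum]
        refine Finset.sum_congr rfl fun x _ => ?_
        ring
    _ = 4 ^ k * (ENNReal.ofReal (3/4)) ^ n := by rw [h2]
    _ ≤ 4 ^ k * (ENNReal.ofReal (3/4)) ^ (256 * k) := by
        refine mul_le_mul' le_rfl (pow_le_pow_right_of_le_one' ?_ hk)
        rw [ENNReal.ofReal_le_one]; norm_num
    _ = (4 * (ENNReal.ofReal (3/4)) ^ 256) ^ k := by rw [pow_mul, mul_pow]
    _ ≤ _ := by
        refine pow_le_pow_left' ?_ k
        rw [← ENNReal.ofReal_pow (by norm_num), ← ENNReal.ofReal_ofNat 4,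
          ← ENNReal.ofReal_mul (by norm_num), ← ENNReal.ofReal_ofNat 2,
          ← ENNReal.ofReal_inv_of_pos (by norm_num)]
        apply ENNReal.ofReal_le_ofReal
        norm_num

lemma VV_init (k : ℕ) (hk1 : 1 ≤ k) (P : Fin μ → BitString n) (hk : 256 * k ≤ n) :
    VV k ((P, decide (∃ i, P i = allZeros n), decide (∃ i, P i = allOnes n)) : State n μ) ≤
    (2⁻¹) ^ k + ∑ i, ∑ b, (if dd b (P i) < 2 * k then 1 else 0) := by
  by_cases h : ∃ i b, dd b (P i) < 2 * k
  · obtain ⟨i, b, h⟩ := h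
    refine (VV_le_one _ _).trans (le_trans ?_ le_add_self)
    refine le_trans ?_ (Finset.single_le_sum (fun _ _ => zero_le) (Finset.mem_univ i))
    refine le_trans ?_ (Finset.single_le_sum (fun _ _ => zero_le) (Finset.mem_univ b))
    rw [if_pos h]
  · push Not at h
    refine le_trans ?_ le_self_add
    have hopt : ∀ b : Bool, ¬ ∃ i, P i = fun _ => b := by
      rintro b ⟨i, hi⟩
      have := (dd_eq_zero b _).2 hi
      have := h i b
      omega
    have h0 : ¬ ∃ i, P i = allZeros n := hopt false
    have h1 : ¬ ∃ i, P i = allOnes n := hopt true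
    unfold VV
    rw [if_neg]
    · apply half_anti
      have h2 : k ≤ AA k true P := by
        rw [le_AA_iff]
        refine ⟨le_rfl, fun i => ?_⟩
        have := h i true; omega
      have := AA_le_XX k true P
      unfold Ph
      simp only
      omega
    · rw [not_or, not_not]
      refine ⟨?_, ?_, ?_, ?_⟩
      · simp [bothFound, h0]
      · intro i j _ _
        simp only
        have := lev_eq true (P i)
        have := h i true; have := h i (!true); omega
      · simp [h0]
      · simp [h1]

lemma init_VV (k : ℕ) (hk1 : 1 ≤ k) (hk : 256 * k ≤ n) :
    ∑ s, init n μ s * VV k s ≤ (2⁻¹) ^ k + μ * (2 * (2⁻¹) ^ k) := by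
  rw [init_sum]
  calc _ ≤ ∑ P : Fin μ → BitString n, ((2 : ℝ≥0∞) ^ (n * μ))⁻¹ *
        ((2⁻¹) ^ k + ∑ i, ∑ b, (if dd b (P i) < 2 * k then 1 else 0)) :=
        Finset.sum_le_sum fun P _ => mul_le_mul' le_rfl (VV_init k hk1 P hk)
    _ = (2⁻¹) ^ k + ∑ i : Fin μ, ∑ b, ∑ P : Fin μ → BitString n, ((2 : ℝ≥0∞) ^ (n * μ))⁻¹ *
          (if dd b (P i) < 2 * k then 1 else 0) := by
        simp only [mul_add, Finset.sum_add_distrib, ← Finset.sum_mul, pop_one, one_mul]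
        congr 1
        simp only [Finset.mul_sum]
        rw [Finset.sum_comm]
        refine Finset.sum_congr rfl fun i _ => ?_
        rw [Finset.sum_comm]
    _ ≤ (2⁻¹) ^ k + ∑ i : Fin μ, ∑ b : Bool, (2⁻¹) ^ k := by
        refine add_le_add le_rfl (Finset.sum_le_sum fun i _ => Finset.sum_le_sum fun b _ => ?_)
        rw [pop_marginal i (fun x => if dd b x < 2 * k then 1 else 0)]
        exact tail_one b k hk
    _ = _ := by simp

lemma evolve_sum (hn : 1 ≤ n) (hμ : 1 ≤ μ) (T : ℕ) :
    ∑ s, evolve (init n μ) (trans n μ) T s = 1 := by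
  induction T with
  | zero =>
    have := init_sum (n := n) (μ := μ) (fun _ => 1)
    simp only [mul_one, pop_one] at this
    exact this
  | succ T ih =>
    simp only [evolve]
    rw [Finset.sum_comm]
    simp only [← Finset.mul_sum, trans_sum hn hμ, mul_one]
    exact ih

lemma evolve_VV (hn : 2 ≤ n) (hμ : 1 ≤ μ) (k : ℕ) (hk1 : 1 ≤ k) (hk : 256 * k ≤ n) (T : ℕ) :
    ∑ s, evolve (init n μ) (trans n μ) T s * VV k s ≤
      ((2⁻¹) ^ k + μ * (2 * (2⁻¹) ^ k)) + T * ((1 + CC) * (2⁻¹) ^ k) := by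
  induction T with
  | zero => simpa [evolve] using init_VV (μ := μ) k hk1 hk
  | succ T ih =>
    simp only [evolve, Finset.sum_mul]
    rw [Finset.sum_comm]
    simp only [mul_assoc, ← Finset.mul_sum]
    calc _ ≤ ∑ s, evolve (init n μ) (trans n μ) T s * (VV k s + (1 + CC) * (2⁻¹) ^ k) :=
          Finset.sum_le_sum fun s _ => mul_le_mul' le_rfl
            (drift hn hμ k hk s (trans_sum (by omega) hμ s))
      _ = ∑ s, evolve (init n μ) (trans n μ) T s * VV k s + (1 + CC) * (2⁻¹) ^ k := by
          simp only [mul_add, Finset.sum_add_distrib, ← Finset.sum_mul,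
            evolve_sum (n := n) (μ := μ) (by omega) hμ T, one_mul]
      _ ≤ _ := by
          refine (add_le_add ih le_rfl).trans (le_of_eq ?_)
          push_cast
          ring

lemma findBoth_le (hn : 2 ≤ n) (hμ : 1 ≤ μ) (k : ℕ) (hk1 : 1 ≤ k) (hk : 256 * k ≤ n) (T : ℕ) :
    findBothProb n μ T ≤ (1 + 2 * μ + T * (1 + CC)) * (2⁻¹) ^ k := by
  refine le_trans ?_ ((evolve_VV hn hμ k hk1 hk T).trans (le_of_eq (by ring)))
  unfold findBothProb probOf
  refine Finset.sum_le_sum fun s _ => ?_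
  split_ifs with h
  · have : VV k s = 1 := by unfold VV; rw [if_pos (Or.inl h)]
    rw [this, mul_one]
  · exact zero_le

def rr : ℝ := (2 : ℝ) ^ (-(1/256) : ℝ)
def qq : ℝ := (2 : ℝ) ^ ((1/1024) : ℝ)
def bb (C n : ℕ) : ℝ :=
  2 * ((1 + 2 * (n : ℝ) ^ C + qq ^ n * (1 + Real.exp 128)) * rr ^ n)

lemma bb_tendsto (C : ℕ) : Tendsto (bb C) atTop (nhds 0) := by
  have hr0 : 0 < rr := by unfold rr; positivity
  have hq0 : 0 < qq := by unfold qq; positivity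
  have hr1 : rr < 1 := Real.rpow_lt_one_of_one_lt_of_neg (by norm_num) (by norm_num)
  have hqr : qq * rr < 1 := by
    unfold qq rr
    rw [← Real.rpow_add (by norm_num)]
    exact Real.rpow_lt_one_of_one_lt_of_neg (by norm_num) (by norm_num)
  have h1 := tendsto_pow_atTop_nhds_zero_of_lt_one hr0.le hr1
  have h2 := tendsto_pow_const_mul_const_pow_of_abs_lt_one C (r := rr) (by
    rw [abs_of_pos hr0]; exact hr1)
  have h3 := tendsto_pow_atTop_nhds_zero_of_lt_one (mul_pos hq0 hr0).le hqr
  have h4 := ((h1.add (h2.const_mul 2)).add (h3.const_mul (1 + Real.exp 128))).const_mul 2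
  simp only [mul_zero, add_zero] at h4
  refine h4.congr fun n => ?_
  unfold bb
  rw [mul_pow]
  ring

lemma qq_pow (n : ℕ) : (2 : ℝ) ^ ((1/1024 : ℝ) * n) = qq ^ n := by
  unfold qq
  rw [Real.rpow_mul_natCast (by norm_num)]

lemma half_pow_bound (n : ℕ) : (2⁻¹ : ℝ) ^ (n / 256) ≤ 2 * rr ^ n := by
  unfold rr
  rw [← Real.rpow_mul_natCast (by norm_num), inv_pow, ← Real.rpow_natCast, ← Real.rpow_neg (by norm_num)]
  nth_rewrite 2 [← Real.rpow_one 2]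
  rw [← Real.rpow_add (by norm_num)]
  apply Real.rpow_le_rpow_of_exponent_le (by norm_num)
  have h : n < 256 * (n / 256 + 1) := by omega
  have h' : (n : ℝ) < 256 * (((n / 256 : ℕ) : ℝ) + 1) := by exact_mod_cast h
  linarith

lemma findBoth_bb (C : ℕ) (hn : 256 ≤ n) (hμ : 1 ≤ μ) (hC : μ ≤ n ^ C) (T : ℕ)
    (hT : T ≤ ⌊(2 : ℝ) ^ ((1/1024 : ℝ) * n)⌋₊) :
    findBothProb n μ T ≤ ENNReal.ofReal (bb C n) := by
  refine (findBoth_le (by omega) hμ (n / 256) (by omega) (by omega) T).trans ?_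
  have hTr : (T : ℝ) ≤ qq ^ n := by
    rw [← qq_pow]
    exact (Nat.cast_le.2 hT).trans (Nat.floor_le (by positivity))
  have hq0 : 0 < qq := by unfold qq; positivity
  have hμr : (μ : ℝ) ≤ (n : ℝ) ^ C := by exact_mod_cast hC
  have e : (1 + 2 * (μ : ℝ≥0∞) + T * (1 + CC)) * (2⁻¹) ^ (n / 256) =
      ENNReal.ofReal ((1 + 2 * (μ : ℝ) + T * (1 + Real.exp 128)) * (2⁻¹) ^ (n / 256)) := by
    rw [ENNReal.ofReal_mul (by positivity), ENNReal.ofReal_pow (by norm_num),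
      ENNReal.ofReal_inv_of_pos (by norm_num), ENNReal.ofReal_add (by positivity) (by positivity),
      ENNReal.ofReal_add (by positivity) (by positivity), ENNReal.ofReal_mul (by positivity),
      ENNReal.ofReal_mul (by positivity), ENNReal.ofReal_add (by positivity) (by positivity),
      ENNReal.ofReal_one, ENNReal.ofReal_natCast, ENNReal.ofReal_natCast, ENNReal.ofReal_ofNat]
    rfl
  rw [e]
  apply ENNReal.ofReal_le_ofReal
  unfold bb
  calc _ ≤ (1 + 2 * (n : ℝ) ^ C + qq ^ n * (1 + Real.exp 128)) * (2 * rr ^ n) := by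
        gcongr
        exact half_pow_bound n
    _ = _ := by ring

lemma not_both (hn : 1 ≤ n) (hμ : 1 ≤ μ) (T : ℕ) (h : findBothProb n μ T ≤ 2⁻¹) :
    2⁻¹ ≤ probOf (evolve (init n μ) (trans n μ) T) fun s => ¬ bothFound s := by
  have hs : findBothProb n μ T + probOf (evolve (init n μ) (trans n μ) T)
      (fun s => ¬ bothFound s) = 1 := by
    unfold findBothProb probOf
    rw [← Finset.sum_add_distrib, ← evolve_sum hn hμ T]
    refine Finset.sum_congr rfl fun s _ => ?_
    by_cases hb : bothFound s <;> simp [hb]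
  have h2 : (2⁻¹ : ℝ≥0∞) + 2⁻¹ ≤ 2⁻¹ + probOf (evolve (init n μ) (trans n μ) T)
      (fun s => ¬ bothFound s) := by
    rw [ENNReal.inv_two_add_inv_two, ← hs]
    exact add_le_add h le_rfl
  exact (ENNReal.add_le_add_iff_left (by norm_num)).1 h2

end Final

/-- adapted from Theorem 3 in Friedrich–Oliveto–Sudholt–Witt:
for every polynomially bounded population size μ = μ(n) ≥ 1, there is a constant c > 0
such that the probability that the (μ+1) EA with fitness diversity on TwoMax finds both
optima within 2^(c·n) generations tends to 0, and the expected number of generations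
until both optima are found is 2^(Ω(n)). -/
theorem muPlusOneEA_TwoMax_fitness_diversity
    (μ : ℕ → ℕ) (hμ1 : ∀ n, 1 ≤ μ n)
    (hμ : ∃ C : ℕ, ∀ᶠ n : ℕ in atTop, μ n ≤ n ^ C) :
    (∃ c : ℝ, 0 < c ∧
      Tendsto (fun n => findBothProb n (μ n) ⌊(2 : ℝ) ^ (c * n)⌋₊) atTop (nhds 0)) ∧
    ∃ c' : ℝ, 0 < c' ∧ ∀ᶠ n : ℕ in atTop,
      ENNReal.ofReal ((2 : ℝ) ^ (c' * n)) ≤ expFindBoth n (μ n) := by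
  obtain ⟨C, hC⟩ := hμ
  refine ⟨⟨1/1024, by norm_num, ?_⟩, 1/2048, by norm_num, ?_⟩
  · have h0 : Tendsto (fun n => ENNReal.ofReal (bb C n)) atTop (nhds 0) := by
      have := ENNReal.tendsto_ofReal (bb_tendsto C)
      simpa using this
    refine tendsto_of_tendsto_of_tendsto_of_le_of_le' tendsto_const_nhds h0
      (Eventually.of_forall fun n => zero_le) ?_
    filter_upwards [hC, eventually_ge_atTop 256] with n h1 h2
    exact findBoth_bb C h2 (hμ1 n) h1 _ le_rfl
  · have hev : ∀ᶠ n in atTop, bb C n ≤ 2⁻¹ :=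
      (bb_tendsto C).eventually (ge_mem_nhds (by norm_num))
    filter_upwards [hC, hev, eventually_ge_atTop 2048] with n h1 h2 h3
    have hb : ENNReal.ofReal (bb C n) ≤ 2⁻¹ := by
      rw [← ENNReal.ofReal_ofNat 2, ← ENNReal.ofReal_inv_of_pos (by norm_num)]
      exact ENNReal.ofReal_le_ofReal h2
    set T0 := ⌊(2 : ℝ) ^ ((1/1024 : ℝ) * n)⌋₊ with hT0
    have hlow : ((T0 + 1 : ℕ) : ℝ≥0∞) * 2⁻¹ ≤ expFindBoth n (μ n) := by
      unfold expFindBoth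
      refine le_trans ?_ (ENNReal.sum_le_tsum (Finset.range (T0 + 1)))
      calc ((T0 + 1 : ℕ) : ℝ≥0∞) * 2⁻¹ = ∑ _T ∈ Finset.range (T0 + 1), (2⁻¹ : ℝ≥0∞) := by
            rw [Finset.sum_const, Finset.card_range, nsmul_eq_mul]
        _ ≤ _ := by
            refine Finset.sum_le_sum fun T hT => ?_
            rw [Finset.mem_range] at hT
            exact not_both (by omega) (hμ1 n) T
              ((findBoth_bb C (by omega) (hμ1 n) h1 T (by omega)).trans hb)
    refine le_trans ?_ hlow
    rw [← ENNReal.ofReal_natCast, ← ENNReal.ofReal_ofNat 2,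
      ← ENNReal.ofReal_inv_of_pos (by norm_num), ← ENNReal.ofReal_mul (by positivity)]
    apply ENNReal.ofReal_le_ofReal
    have h4 : (2 : ℝ) ^ ((1/1024 : ℝ) * n) ≤ ((T0 + 1 : ℕ) : ℝ) := by
      push_cast
      exact (Nat.lt_floor_add_one _).le
    have h5 : (2 : ℝ) ^ ((1/2048 : ℝ) * n) * 2 ≤ (2 : ℝ) ^ ((1/1024 : ℝ) * n) := by
      nth_rewrite 2 [← Real.rpow_one 2]
      rw [← Real.rpow_add (by norm_num)]
      apply Real.rpow_le_rpow_of_exponent_le (by norm_num)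
      have : (2048 : ℝ) ≤ n := by exact_mod_cast h3
      linarith
    linarith

end Stmt2
end
end

section
/- For every polynomially bounded population size function µ = µ(n) ≤ n^{O(1)}, the (µ+1) EA with deterministic crowding run on TwoMax reaches a population consisting only of global optima (search points in {0^n, 1^n}) in expected O(µ n log n) generations, and the probability that this final population contains both 0^n and 1^n is at least 1 − 2^{−µ+1}. -/
open Filter
open scoped ENNReal BigOperators Classical

noncomputable section

namespace Stmt3

/-- all population members are global optima of TwoMax -/
def allOpt {n μ : ℕ} (P : Fin μ → BitString n) : Prop :=
  ∀ i, P i = allZeros n ∨ P i = allOnes n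

/-- the population contains both global optima -/
def containsBoth {n μ : ℕ} (P : Fin μ → BitString n) : Prop :=
  (∃ i, P i = allZeros n) ∧ ∃ i, P i = allOnes n

/-- State of a run: the current population, a flag recording whether a population
consisting only of global optima has been reached, and a flag recording whether at the
first moment this happened the population contained both optima. -/
abbrev State (n μ : ℕ) := (Fin μ → BitString n) × Bool × Bool

/-- flag update when moving to population `Q` -/
def updFlags {n μ : ℕ} (f : Bool × Bool) (Q : Fin μ → BitString n) : Bool × Bool :=
  if f.1 then f else if allOpt Q then (true, decide (containsBoth Q)) else (false, false)

/-- One generation of the (μ+1) EA with deterministic crowding on TwoMax: choose a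
parent uniformly at random, mutate it, and replace the parent by the offspring if the
offspring is at least as fit (the offspring competes only against its own parent). -/
def trans (n μ : ℕ) : State n μ → State n μ → ℝ≥0∞ := fun s s' =>
  ∑ i : Fin μ, (μ : ℝ≥0∞)⁻¹ * ∑ y : BitString n, mutProb n (s.1 i) y *
    (if s'.1 = (if twoMax (s.1 i) ≤ twoMax y then Function.update s.1 i y else s.1) ∧
        s'.2 = updFlags s.2 s'.1
      then 1 else 0)

/-- Initialization: uniform over all populations of μ bit strings of length n. -/
def init (n μ : ℕ) : State n μ → ℝ≥0∞ := fun s =>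
  ((2 : ℝ≥0∞) ^ (n * μ))⁻¹ * (if s.2 = updFlags (false, false) s.1 then 1 else 0)

/-- expected number of generations until the population consists only of global optima -/
def expAllOpt (n μ : ℕ) : ℝ≥0∞ :=
  ∑' T : ℕ, probOf (evolve (init n μ) (trans n μ) T) fun s => ¬ s.2.1 = true

/-- probability that, at the first moment the population consists only of global optima,
it contains both optima -/
def probBothAtEnd (n μ : ℕ) : ℝ≥0∞ :=
  ⨆ T : ℕ, probOf (evolve (init n μ) (trans n μ) T) fun s => s.2.2 = true


lemma mutProb_eq_prod {n : ℕ} (x y : BitString n) :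
    mutProb n x y = ∏ i, (if y i = x i then (1 - (n : ℝ≥0∞)⁻¹) else (n : ℝ≥0∞)⁻¹) := by
  have h1 : (Finset.univ.filter fun i => ¬ (y i = x i)).card = hammingDist x y := by
    rw [hammingDist_comm]; rfl
  have h2 := Finset.card_filter_add_card_filter_not (s := (Finset.univ : Finset (Fin n))) (fun i => y i = x i)
  have h3 : (Finset.univ.filter fun i => y i = x i).card = n - hammingDist x y := by
    simp only [Finset.card_univ, Fintype.card_fin] at h2
    omega
  rw [Finset.prod_ite, Finset.prod_const, Finset.prod_const, h1, h3, mul_comm]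
  rfl

lemma sum_mutProb {n : ℕ} (x : BitString n) : ∑ y, mutProb n x y = 1 := by
  simp_rw [mutProb_eq_prod]
  have h := Finset.prod_univ_sum (fun _ : Fin n => (Finset.univ : Finset Bool))
    (fun i b => (if b = x i then (1 - (n : ℝ≥0∞)⁻¹) else (n : ℝ≥0∞)⁻¹))
  rw [Fintype.piFinset_univ] at h
  rw [← h]
  apply Finset.prod_eq_one
  intro i _
  have hn : (n : ℝ≥0∞)⁻¹ ≤ 1 := by
    rw [ENNReal.inv_le_one]
    have : 1 ≤ n := by have := i.2; omega
    exact_mod_cast this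
  rw [Fintype.sum_bool]
  cases x i <;> simp [tsub_add_cancel_of_le hn, add_tsub_cancel_of_le hn]

/-- next population -/
def nxt {n μ : ℕ} (P : Fin μ → BitString n) (i : Fin μ) (y : BitString n) : Fin μ → BitString n :=
  if twoMax (P i) ≤ twoMax y then Function.update P i y else P

/-- one step operator -/
def K {n μ : ℕ} (g : State n μ → ℝ≥0∞) (s : State n μ) : ℝ≥0∞ :=
  ∑ i : Fin μ, (μ : ℝ≥0∞)⁻¹ * ∑ y : BitString n, mutProb n (s.1 i) y *
    g (nxt s.1 i y, updFlags s.2 (nxt s.1 i y))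

lemma sum_trans {n μ : ℕ} (g : State n μ → ℝ≥0∞) (s : State n μ) :
    ∑ s', trans n μ s s' * g s' = K g s := by
  unfold trans K
  simp_rw [Finset.sum_mul]
  rw [Finset.sum_comm]
  refine Finset.sum_congr rfl fun i _ => ?_
  simp_rw [mul_assoc, Finset.sum_mul]
  rw [← Finset.mul_sum, Finset.sum_comm]
  congr 1
  refine Finset.sum_congr rfl fun y _ => ?_
  simp_rw [mul_assoc]
  rw [← Finset.mul_sum]
  congr 1
  change ∑ s' : State n μ, (if s'.1 = nxt s.1 i y ∧ s'.2 = updFlags s.2 s'.1 then (1 : ℝ≥0∞) else 0) * g s' = _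
  rw [Finset.sum_eq_single (nxt s.1 i y, updFlags s.2 (nxt s.1 i y))]
  · simp
  · rintro ⟨Q, f⟩ _ hne
    rw [if_neg, zero_mul]
    rintro ⟨h1, h2⟩
    apply hne
    simp only at h1 h2
    rw [h2, h1]
  · simp

/-- expectation -/
def ex {n μ : ℕ} (T : ℕ) (g : State n μ → ℝ≥0∞) : ℝ≥0∞ :=
  ∑ s, evolve (init n μ) (trans n μ) T s * g s

lemma ex_succ {n μ : ℕ} (T : ℕ) (g : State n μ → ℝ≥0∞) : ex (T+1) g = ex T (K g) := by
  unfold ex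
  simp_rw [← sum_trans, evolve, Finset.sum_mul, Finset.mul_sum]
  rw [Finset.sum_comm]
  simp_rw [mul_assoc]

lemma ex_iter {n μ : ℕ} (T : ℕ) (g : State n μ → ℝ≥0∞) : ex T g = ex 0 (K^[T] g) := by
  induction T generalizing g with
  | zero => rfl
  | succ T ih => rw [ex_succ, ih]; rfl

lemma probOf_eq {n μ : ℕ} (T : ℕ) (A : State n μ → Prop) :
    probOf (evolve (init n μ) (trans n μ) T) A = ex T (fun s => if A s then 1 else 0) := by
  unfold probOf ex
  refine Finset.sum_congr rfl fun s _ => ?_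
  by_cases h : A s <;> simp [h]

lemma ex_mono {n μ : ℕ} (T : ℕ) {g h : State n μ → ℝ≥0∞} (H : ∀ s, g s ≤ h s) : ex T g ≤ ex T h :=
  Finset.sum_le_sum fun s _ => mul_le_mul_right (H s) _

lemma ex_mul {n μ : ℕ} (T : ℕ) (c : ℝ≥0∞) (g : State n μ → ℝ≥0∞) :
    ex T (fun s => c * g s) = c * ex T g := by
  unfold ex
  rw [Finset.mul_sum]
  refine Finset.sum_congr rfl fun s _ => ?_
  ring

/-- initial state with population P -/
def st {n μ : ℕ} (P : Fin μ → BitString n) : State n μ := (P, updFlags (false, false) P)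

lemma ex_zero {n μ : ℕ} (g : State n μ → ℝ≥0∞) :
    ex 0 g = ((2 : ℝ≥0∞) ^ (n * μ))⁻¹ * ∑ P, g (st P) := by
  unfold ex evolve init
  simp_rw [mul_assoc]
  rw [← Finset.mul_sum, Fintype.sum_prod_type]
  congr 1
  refine Finset.sum_congr rfl fun P _ => ?_
  rw [Finset.sum_eq_single (updFlags (false, false) P)]
  · simp [st]
  · intro f _ hne
    simp [hne]
  · simp

lemma K_one {n μ : ℕ} (hμ : 1 ≤ μ) (s : State n μ) : K (fun _ => 1) s = 1 := by
  unfold K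
  simp only [mul_one, sum_mutProb, Finset.sum_const, Finset.card_univ, Fintype.card_fin, nsmul_eq_mul]
  apply ENNReal.mul_inv_cancel
  · have : μ ≠ 0 := by omega
    exact_mod_cast this
  · simp

lemma ex_one {n μ : ℕ} (hμ : 1 ≤ μ) (T : ℕ) : ex T (fun _ : State n μ => 1) = 1 := by
  induction T with
  | zero =>
    rw [ex_zero]
    simp only [Finset.sum_const, Finset.card_univ, nsmul_eq_mul, mul_one]
    have : Fintype.card (Fin μ → BitString n) = 2 ^ (n * μ) := by
      simp [pow_mul]
    rw [this]
    push_cast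
    apply ENNReal.inv_mul_cancel <;> simp
  | succ T ih =>
    rw [ex_succ]
    have : K (fun _ : State n μ => 1) = fun _ => 1 := funext (K_one hμ)
    rw [this, ih]

lemma supp {n μ : ℕ} (T : ℕ) (s : State n μ) (h1 : s.2.1 = false) (h2 : allOpt s.1) :
    evolve (init n μ) (trans n μ) T s = 0 := by
  have key : ∀ f, s.2 ≠ updFlags f s.1 := by
    intro f h
    unfold updFlags at h
    rw [h] at h1
    split_ifs at h1 with h3
    simp [h3] at h1
  cases T with
  | zero => simp [evolve, init, key]
  | succ T => simp [evolve, trans, key]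

/-- distance to the optimum -/
def dst {n : ℕ} (x : BitString n) : ℕ := n - twoMax x

lemma onesCount_le {n : ℕ} (x : BitString n) : onesCount x ≤ n := by
  unfold onesCount
  exact (Finset.card_le_univ _).trans (by simp)

lemma zerosCount {n : ℕ} (x : BitString n) :
    (Finset.univ.filter fun i => x i = false).card = n - onesCount x := by
  have h2 := Finset.card_filter_add_card_filter_not (s := (Finset.univ : Finset (Fin n))) (fun i => x i = true)
  simp only [Finset.card_univ, Fintype.card_fin, Bool.not_eq_true] at h2
  unfold onesCount
  omega

lemma dst_zero {n : ℕ} (x : BitString n) (h : dst x = 0) : x = allZeros n ∨ x = allOnes n := by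
  have h1 := onesCount_le x
  unfold dst twoMax at h
  have h2 : onesCount x = 0 ∨ n - onesCount x = 0 := by
    rcases le_total (onesCount x) (n - onesCount x) with h' | h'
    · rw [max_eq_right h'] at h; omega
    · rw [max_eq_left h'] at h; omega
  rcases h2 with h2 | h2
  · left
    unfold onesCount at h2
    rw [Finset.card_eq_zero, Finset.filter_eq_empty_iff] at h2
    funext i
    simpa [allZeros] using h2 (Finset.mem_univ i)
  · right
    rw [← zerosCount, Finset.card_eq_zero, Finset.filter_eq_empty_iff] at h2
    funext i
    simpa [allOnes] using h2 (Finset.mem_univ i)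

/-- one bit flip -/
def flip1 {n : ℕ} (x : BitString n) (j : Fin n) : BitString n := Function.update x j (!x j)

lemma hd_flip1 {n : ℕ} (x : BitString n) (j : Fin n) : hammingDist x (flip1 x j) = 1 := by
  unfold hammingDist flip1
  rw [Finset.card_eq_one]
  refine ⟨j, ?_⟩
  ext k
  by_cases h : k = j
  · subst h; simp
  · simp [h]

lemma flip1_inj {n : ℕ} (x : BitString n) : Function.Injective (flip1 x) := by
  intro j k h
  by_contra hne
  have := congrFun h j
  simp [flip1, hne] at this

lemma ones_flip1_false {n : ℕ} (x : BitString n) (j : Fin n) (h : x j = false) :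
    onesCount (flip1 x j) = onesCount x + 1 := by
  unfold onesCount
  have : (Finset.univ.filter fun i => flip1 x j i = true) =
      insert j (Finset.univ.filter fun i => x i = true) := by
    ext k
    simp only [Finset.mem_filter, Finset.mem_insert, Finset.mem_univ, true_and]
    by_cases hk : k = j
    · subst hk; simp [flip1, h]
    · simp [flip1, hk]
  rw [this, Finset.card_insert_of_notMem (by simp [h])]

lemma ones_flip1_true {n : ℕ} (x : BitString n) (j : Fin n) (h : x j = true) :
    onesCount (flip1 x j) + 1 = onesCount x := by
  unfold onesCount
  have : (Finset.univ.filter fun i => x i = true) =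
      insert j (Finset.univ.filter fun i => flip1 x j i = true) := by
    ext k
    simp only [Finset.mem_filter, Finset.mem_insert, Finset.mem_univ, true_and]
    by_cases hk : k = j
    · subst hk; simp [flip1, h]
    · simp [flip1, hk]
  rw [this, Finset.card_insert_of_notMem (by simp [flip1, h])]

lemma exists_impr {n : ℕ} (x : BitString n) : ∃ S : Finset (Fin n), S.card = dst x ∧
    ∀ j ∈ S, twoMax x + 1 ≤ twoMax (flip1 x j) := by
  have h1 := onesCount_le x
  rcases le_total (onesCount x) (n - onesCount x) with h' | h'
  · refine ⟨Finset.univ.filter fun i => x i = true, ?_, ?_⟩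
    · change onesCount x = _
      unfold dst twoMax; rw [max_eq_right h']; omega
    · intro j hj
      have := ones_flip1_true x j (by simpa using hj)
      unfold twoMax; rw [max_eq_right h']
      refine le_trans ?_ (le_max_right _ _)
      omega
  · refine ⟨Finset.univ.filter fun i => x i = false, ?_, ?_⟩
    · rw [zerosCount]
      unfold dst twoMax; rw [max_eq_left h']
    · intro j hj
      have := ones_flip1_false x j (by simpa using hj)
      unfold twoMax; rw [max_eq_left h']
      refine le_trans ?_ (le_max_left _ _)
      omega

lemma q_bound {n : ℕ} (hn : 1 ≤ n) : Real.exp (-1) ≤ (1 - (n : ℝ)⁻¹) ^ (n - 1) := by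
  obtain ⟨m, rfl⟩ : ∃ m, n = m + 1 := ⟨n - 1, by omega⟩
  rcases Nat.eq_zero_or_pos m with rfl | hm
  · simp
  have hm' : (0 : ℝ) < m := by exact_mod_cast hm
  have h1 : 1 - ((m + 1 : ℕ) : ℝ)⁻¹ = (1 + 1 / (m : ℝ))⁻¹ := by
    push_cast
    field_simp
    ring
  have h2 : 1 + 1 / (m : ℝ) ≤ Real.exp (1 / m) := by
    have := Real.add_one_le_exp (1 / (m : ℝ)); linarith
  have h3 : (1 + 1 / (m : ℝ)) ^ m ≤ Real.exp 1 := by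
    calc (1 + 1 / (m : ℝ)) ^ m ≤ (Real.exp (1 / m)) ^ m := by gcongr
      _ = Real.exp 1 := by rw [← Real.exp_nat_mul]; congr 1; field_simp
  rw [h1, Real.exp_neg, Nat.add_sub_cancel, inv_pow]
  gcongr

lemma mut_flip1 {n : ℕ} (x : BitString n) (j : Fin n) :
    ENNReal.ofReal (Real.exp (-1) * (n : ℝ)⁻¹) ≤ mutProb n x (flip1 x j) := by
  have hn : 1 ≤ n := by have := j.2; omega
  have hn' : (0 : ℝ) < n := by exact_mod_cast hn
  have h0 : (n : ℝ≥0∞)⁻¹ = ENNReal.ofReal ((n : ℝ)⁻¹) := by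
    rw [ENNReal.ofReal_inv_of_pos hn', ENNReal.ofReal_natCast]
  unfold mutProb
  have hle : 0 ≤ 1 - (n : ℝ)⁻¹ := by
    have : (n : ℝ)⁻¹ ≤ 1 := inv_le_one_of_one_le₀ (by exact_mod_cast hn)
    linarith
  rw [hd_flip1, h0, pow_one, ← ENNReal.ofReal_one, ← ENNReal.ofReal_sub _ (by positivity),
    ← ENNReal.ofReal_pow hle, ← ENNReal.ofReal_mul (by positivity)]
  apply ENNReal.ofReal_le_ofReal
  rw [mul_comm]
  have := q_bound hn
  gcongr

/-- potential -/
def Phi {n μ : ℕ} (P : Fin μ → BitString n) : ℕ := ∑ i, dst (P i)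

lemma Phi_nxt {n μ : ℕ} (P : Fin μ → BitString n) (i : Fin μ) (y : BitString n) :
    Phi (nxt P i y) + (if twoMax (P i) + 1 ≤ twoMax y then 1 else 0) ≤ Phi P := by
  have hy : twoMax y ≤ n := by
    have := onesCount_le y
    unfold twoMax; apply max_le <;> omega
  unfold nxt
  by_cases h : twoMax (P i) ≤ twoMax y
  · rw [if_pos h]
    unfold Phi
    rw [← Finset.add_sum_erase _ _ (Finset.mem_univ i)]
    rw [← Finset.add_sum_erase _ (fun i => dst (P i)) (Finset.mem_univ i)]
    have : ∑ k ∈ Finset.univ.erase i, dst (Function.update P i y k) =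
        ∑ k ∈ Finset.univ.erase i, dst (P k) := by
      refine Finset.sum_congr rfl fun k hk => ?_
      rw [Function.update_of_ne (by simpa using hk)]
    rw [this, Function.update_self]
    unfold dst
    split_ifs <;> omega
  · rw [if_neg h, if_neg (by omega)]
    simp

/-- drift rate -/
def dl (n μ : ℕ) : ℝ := (μ : ℝ)⁻¹ * (Real.exp (-1) * (n : ℝ)⁻¹)

lemma impr_prob {n : ℕ} (x : BitString n) :
    (dst x : ℝ≥0∞) * ENNReal.ofReal (Real.exp (-1) * (n : ℝ)⁻¹) ≤
      ∑ y, mutProb n x y * (if twoMax x + 1 ≤ twoMax y then 1 else 0) := by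
  obtain ⟨S, hS, hS'⟩ := exists_impr x
  calc _ = ∑ j ∈ S, ENNReal.ofReal (Real.exp (-1) * (n : ℝ)⁻¹) := by simp [hS]
    _ ≤ ∑ j ∈ S, mutProb n x (flip1 x j) * (if twoMax x + 1 ≤ twoMax (flip1 x j) then 1 else 0) := by
      refine Finset.sum_le_sum fun j hj => ?_
      rw [if_pos (hS' j hj), mul_one]
      exact mut_flip1 x j
    _ = ∑ y ∈ S.image (flip1 x), mutProb n x y * (if twoMax x + 1 ≤ twoMax y then 1 else 0) := by
      rw [Finset.sum_image (fun a _ b _ h => flip1_inj x h)]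
    _ ≤ _ := Finset.sum_le_sum_of_subset (Finset.subset_univ _)

lemma drift {n μ : ℕ} (hμ : 1 ≤ μ) (s : State n μ) :
    K (fun s => (Phi s.1 : ℝ≥0∞)) s ≤ (1 - ENNReal.ofReal (dl n μ)) * (Phi s.1 : ℝ≥0∞) := by
  have hμ' : (0 : ℝ) < μ := by exact_mod_cast hμ
  have h0 : (μ : ℝ≥0∞)⁻¹ = ENNReal.ofReal ((μ : ℝ)⁻¹) := by
    rw [ENNReal.ofReal_inv_of_pos hμ', ENNReal.ofReal_natCast]
  have hdl : ENNReal.ofReal (dl n μ) = (μ : ℝ≥0∞)⁻¹ * ENNReal.ofReal (Real.exp (-1) * (n : ℝ)⁻¹) := by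
    rw [h0, ← ENNReal.ofReal_mul (by positivity)]; rfl
  rw [ENNReal.sub_mul (fun _ _ => by simp), one_mul]
  apply ENNReal.le_sub_of_add_le_right (by finiteness)
  have h1 : ENNReal.ofReal (dl n μ) * (Phi s.1 : ℝ≥0∞) ≤
      ∑ i : Fin μ, (μ : ℝ≥0∞)⁻¹ * ∑ y : BitString n, mutProb n (s.1 i) y *
        (if twoMax (s.1 i) + 1 ≤ twoMax y then 1 else 0) := by
    rw [hdl, ← Finset.mul_sum, mul_assoc]
    gcongr
    unfold Phi
    push_cast
    rw [Finset.mul_sum]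
    refine Finset.sum_le_sum fun i _ => ?_
    rw [mul_comm]
    exact impr_prob _
  calc _ ≤ K (fun s => (Phi s.1 : ℝ≥0∞)) s + ∑ i : Fin μ, (μ : ℝ≥0∞)⁻¹ * ∑ y : BitString n, mutProb n (s.1 i) y *
        (if twoMax (s.1 i) + 1 ≤ twoMax y then 1 else 0) := by gcongr
    _ = ∑ i : Fin μ, (μ : ℝ≥0∞)⁻¹ * ∑ y : BitString n, mutProb n (s.1 i) y *
        ((Phi (nxt s.1 i y) : ℝ≥0∞) + (if twoMax (s.1 i) + 1 ≤ twoMax y then 1 else 0)) := by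
      unfold K
      simp_rw [mul_add, Finset.sum_add_distrib, mul_add]
      rw [Finset.sum_add_distrib]
    _ ≤ ∑ i : Fin μ, (μ : ℝ≥0∞)⁻¹ * ∑ y : BitString n, mutProb n (s.1 i) y * (Phi s.1 : ℝ≥0∞) := by
      gcongr with i _ y _
      have := Phi_nxt s.1 i y
      exact_mod_cast this
    _ = K (fun _ => 1) s * (Phi s.1 : ℝ≥0∞) := by
      unfold K
      simp_rw [← Finset.sum_mul, mul_one, ← mul_assoc, ← Finset.sum_mul]
    _ = _ := by rw [K_one hμ, one_mul]

lemma ex_Phi {n μ : ℕ} (hμ : 1 ≤ μ) (T : ℕ) : ex T (fun s : State n μ => (Phi s.1 : ℝ≥0∞)) ≤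
    (1 - ENNReal.ofReal (dl n μ)) ^ T * ((μ * n : ℕ) : ℝ≥0∞) := by
  induction T with
  | zero =>
    rw [pow_zero, one_mul]
    calc _ ≤ ex 0 (fun s : State n μ => ((μ * n : ℕ) : ℝ≥0∞) * 1) := by
          apply ex_mono
          intro s
          rw [mul_one]
          have : Phi s.1 ≤ μ * n := by
            unfold Phi
            calc _ ≤ ∑ i : Fin μ, n := Finset.sum_le_sum fun i _ => by unfold dst; omega
              _ = _ := by simp
          exact_mod_cast this
      _ = _ := by rw [ex_mul, ex_one hμ, mul_one]
  | succ T ih =>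
    rw [ex_succ]
    refine (ex_mono T (drift hμ)).trans ?_
    rw [ex_mul, pow_succ', mul_assoc]
    gcongr

/-- probability of not being finished -/
def nf (n μ T : ℕ) : ℝ≥0∞ := probOf (evolve (init n μ) (trans n μ) T) fun s => ¬ s.2.1 = true

lemma nf_le_one {n μ : ℕ} (hμ : 1 ≤ μ) (T : ℕ) : nf n μ T ≤ 1 := by
  unfold nf
  rw [probOf_eq]
  refine (ex_mono T (h := fun _ => 1) ?_).trans (ex_one hμ T).le
  intro s
  by_cases h : s.2.1 = true <;> simp [h]

lemma nf_le {n μ : ℕ} (hμ : 1 ≤ μ) (T : ℕ) :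
    nf n μ T ≤ (1 - ENNReal.ofReal (dl n μ)) ^ T * ((μ * n : ℕ) : ℝ≥0∞) := by
  refine le_trans ?_ (ex_Phi hμ T)
  unfold nf probOf ex
  refine Finset.sum_le_sum fun s _ => ?_
  split_ifs with h
  · by_cases h2 : allOpt s.1
    · rw [supp T s (by simpa using h) h2]; simp
    · have : 1 ≤ Phi s.1 := by
        by_contra h3
        apply h2
        have h4 : Phi s.1 = 0 := by omega
        unfold Phi at h4
        rw [Finset.sum_eq_zero_iff] at h4
        intro i
        exact dst_zero _ (h4 i (Finset.mem_univ i))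
      have h5 : (1 : ℝ≥0∞) ≤ (Phi s.1 : ℝ≥0∞) := by exact_mod_cast this
      calc _ = evolve (init n μ) (trans n μ) T s * 1 := by rw [mul_one]
        _ ≤ _ := by gcongr
  · simp

lemma dl_pos {n μ : ℕ} (hn : 1 ≤ n) (hμ : 1 ≤ μ) : 0 < dl n μ := by
  unfold dl
  have : (0 : ℝ) < n := by exact_mod_cast hn
  have : (0 : ℝ) < μ := by exact_mod_cast hμ
  positivity

lemma dl_le {n μ : ℕ} (hn : 1 ≤ n) (hμ : 1 ≤ μ) : dl n μ ≤ 1 := by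
  unfold dl
  have h1 : (n : ℝ)⁻¹ ≤ 1 := inv_le_one_of_one_le₀ (by exact_mod_cast hn)
  have h2 : (μ : ℝ)⁻¹ ≤ 1 := inv_le_one_of_one_le₀ (by exact_mod_cast hμ)
  have h3 : Real.exp (-1) ≤ 1 := Real.exp_le_one_iff.mpr (by norm_num)
  exact mul_le_one₀ h2 (by positivity) (mul_le_one₀ h3 (by positivity) h1)

lemma geo_small {d B : ℝ} (hd : 0 < d) (hd1 : d ≤ 1) (hB : 1 ≤ B) {T0 : ℕ}
    (hT' : Real.log B / d ≤ T0) : (1 - ENNReal.ofReal d) ^ T0 * ENNReal.ofReal B ≤ 1 := by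
  have hr : 1 - ENNReal.ofReal d = ENNReal.ofReal (1 - d) := by
    rw [ENNReal.ofReal_sub _ hd.le, ENNReal.ofReal_one]
  have hp : 0 ≤ (1 - d) ^ T0 := by apply pow_nonneg; linarith
  rw [hr, ← ENNReal.ofReal_pow (by linarith), ← ENNReal.ofReal_mul hp, ENNReal.ofReal_le_one]
  have h1 : (1 - d) ^ T0 ≤ Real.exp (-(Real.log B)) := by
    calc (1 - d) ^ T0 ≤ (Real.exp (-d)) ^ T0 := by
          apply pow_le_pow_left₀ (by linarith)
          have := Real.add_one_le_exp (-d); linarith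
      _ = Real.exp (-(T0 * d)) := by rw [← Real.exp_nat_mul]; congr 1; ring
      _ ≤ _ := by
        apply Real.exp_le_exp.mpr
        rw [div_le_iff₀ hd] at hT'
        linarith
  rw [Real.exp_neg, Real.exp_log (by linarith)] at h1
  calc _ ≤ B⁻¹ * B := by gcongr
    _ = 1 := inv_mul_cancel₀ (by linarith)

lemma sum_bound {d B : ℝ} (hd : 0 < d) (hd1 : d ≤ 1) (hB : 1 ≤ B) (a : ℕ → ℝ≥0∞)
    (ha : ∀ T, a T ≤ 1) (ha' : ∀ T, a T ≤ (1 - ENNReal.ofReal d) ^ T * ENNReal.ofReal B) :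
    ∑' T, a T ≤ ENNReal.ofReal (Real.log B / d + 1 + 1 / d) := by
  have hlog : 0 ≤ Real.log B := Real.log_nonneg hB
  obtain ⟨T0, hT, hT'⟩ : ∃ T0 : ℕ, (T0 : ℝ) ≤ Real.log B / d + 1 ∧ Real.log B / d ≤ T0 :=
    ⟨⌈Real.log B / d⌉₊, (Nat.ceil_lt_add_one (by positivity)).le, Nat.le_ceil _⟩
  have hsmall := geo_small hd hd1 hB hT'
  have hsplit : ∑' T, a T = ∑ T ∈ Finset.range T0, a T + ∑' T, a (T + T0) :=
    (Summable.sum_add_tsum_nat_add' (f := a) (k := T0) ENNReal.summable).symm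
  rw [hsplit]
  have h1 : ∑ T ∈ Finset.range T0, a T ≤ ENNReal.ofReal (Real.log B / d + 1) := by
    calc _ ≤ ∑ T ∈ Finset.range T0, (1 : ℝ≥0∞) := Finset.sum_le_sum fun T _ => ha T
      _ = ENNReal.ofReal T0 := by simp
      _ ≤ _ := ENNReal.ofReal_le_ofReal hT
  have h2 : ∑' T, a (T + T0) ≤ ENNReal.ofReal (1 / d) := by
    calc _ ≤ ∑' T : ℕ, (1 - ENNReal.ofReal d) ^ T := by
          refine ENNReal.tsum_le_tsum fun T => (ha' _).trans ?_
          rw [pow_add, mul_assoc]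
          calc _ ≤ (1 - ENNReal.ofReal d) ^ T * 1 := by gcongr
            _ = _ := mul_one _
      _ = _ := by
        rw [ENNReal.tsum_geometric, ENNReal.sub_sub_cancel (by simp) (by simpa using hd1), one_div,
          ENNReal.ofReal_inv_of_pos hd]
  rw [ENNReal.ofReal_add (by positivity) (by positivity)]
  exact add_le_add h1 h2

lemma exp_bound {n μ : ℕ} (hn : 1 ≤ n) (hμ : 1 ≤ μ) :
    expAllOpt n μ ≤ ENNReal.ofReal (Real.log (μ * n) / dl n μ + 1 + 1 / dl n μ) := by
  have hB : (1 : ℝ) ≤ μ * n := by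
    have : 1 ≤ μ * n := Nat.mul_pos hμ hn
    exact_mod_cast this
  refine sum_bound (dl_pos hn hμ) (dl_le hn hμ) hB (nf n μ) (nf_le_one hμ) fun T => ?_
  have h := nf_le (n := n) hμ T
  rwa [← ENNReal.ofReal_natCast, Nat.cast_mul] at h

lemma part1 (μ : ℕ → ℕ) (hμ1 : ∀ n, 1 ≤ μ n)
    (hμ : ∃ C : ℕ, ∀ᶠ n : ℕ in atTop, μ n ≤ n ^ C) :
    ∃ C : ℝ, 0 < C ∧ ∀ᶠ n : ℕ in atTop,
      expAllOpt n (μ n) ≤ ENNReal.ofReal (C * μ n * n * Real.log n) := by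
  obtain ⟨C, hC⟩ := hμ
  refine ⟨Real.exp 1 * (C + 2) + 1, by positivity, ?_⟩
  filter_upwards [hC, eventually_ge_atTop 3] with n hn h3
  refine (exp_bound (by omega) (hμ1 n)).trans (ENNReal.ofReal_le_ofReal ?_)
  have hn0 : (3 : ℝ) ≤ n := by exact_mod_cast h3
  have hm0 : (1 : ℝ) ≤ μ n := by exact_mod_cast hμ1 n
  have hl : 1 ≤ Real.log n := by
    rw [Real.le_log_iff_exp_le (by linarith)]
    have := Real.exp_one_lt_d9; linarith
  have hB : Real.log (μ n * n) ≤ (C + 1) * Real.log n := by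
    rw [Real.log_mul (by linarith) (by linarith)]
    have : Real.log (μ n) ≤ C * Real.log n := by
      rw [← Real.log_pow]
      apply Real.log_le_log (by linarith)
      exact_mod_cast hn
    linarith
  have hd : 1 / dl n (μ n) = Real.exp 1 * (μ n * n) := by
    unfold dl
    rw [Real.exp_neg]
    field_simp
  rw [div_eq_mul_one_div, hd]
  have he : 0 < Real.exp 1 := Real.exp_pos 1
  set X := (μ n : ℝ) * n with hX
  have hX1 : 1 ≤ X := by nlinarith
  set L := Real.log n
  have h1 : Real.log X * (Real.exp 1 * X) ≤ (C + 1) * L * (Real.exp 1 * X) := by gcongr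
  have h2 : Real.exp 1 * X * 1 ≤ Real.exp 1 * X * L := by gcongr
  have h4 : 1 ≤ X * L := by nlinarith
  calc _ ≤ (C + 1) * L * (Real.exp 1 * X) + X * L + Real.exp 1 * X * L := by linarith
    _ = _ := by rw [hX]; ring

/-- complement if c -/
def fl {n : ℕ} (c : Bool) (x : BitString n) : BitString n := fun j => xor c (x j)

lemma fl_fl {n : ℕ} (c : Bool) (x : BitString n) : fl c (fl c x) = x := by
  funext j; simp [fl]

lemma ones_fl {n : ℕ} (x : BitString n) : onesCount (fl true x) = n - onesCount x := by
  rw [← zerosCount]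
  unfold onesCount
  congr 1
  ext j
  simp [fl]

lemma fl_false {n : ℕ} (x : BitString n) : fl false x = x := by
  funext j; simp [fl]

lemma twoMax_fl {n : ℕ} (c : Bool) (x : BitString n) : twoMax (fl c x) = twoMax x := by
  cases c
  · rw [fl_false]
  · have := onesCount_le x
    unfold twoMax
    rw [ones_fl, max_comm]
    congr 1
    omega

lemma mut_fl {n : ℕ} (c : Bool) (x y : BitString n) : mutProb n (fl c x) (fl c y) = mutProb n x y := by
  have : hammingDist (fl c x) (fl c y) = hammingDist x y :=
    hammingDist_comp (fun _ b => xor c b) (fun _ a b h => by simpa using h)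
  unfold mutProb
  rw [this]

/-- lineage-wise complement -/
def sg {n μ : ℕ} (c : Fin μ → Bool) (P : Fin μ → BitString n) : Fin μ → BitString n :=
  fun i => fl (c i) (P i)

lemma sg_sg {n μ : ℕ} (c : Fin μ → Bool) (P : Fin μ → BitString n) : sg c (sg c P) = P := by
  funext i; simp [sg, fl_fl]

lemma nxt_sg {n μ : ℕ} (c : Fin μ → Bool) (P : Fin μ → BitString n) (i : Fin μ) (y : BitString n) :
    nxt (sg c P) i (fl (c i) y) = sg c (nxt P i y) := by
  unfold nxt
  have : twoMax (sg c P i) = twoMax (P i) := twoMax_fl _ _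
  rw [this, twoMax_fl]
  split_ifs
  · funext k
    by_cases hk : k = i
    · subst hk; simp [sg]
    · simp [sg, hk]
  · rfl

lemma opt_fl {n : ℕ} (c : Bool) (x : BitString n) (h : x = allZeros n ∨ x = allOnes n) :
    fl c x = allZeros n ∨ fl c x = allOnes n := by
  rcases h with rfl | rfl <;> cases c
  · left; funext j; simp [fl, allZeros]
  · right; funext j; simp [fl, allZeros, allOnes]
  · right; funext j; simp [fl, allOnes]
  · left; funext j; simp [fl, allZeros, allOnes]

lemma allOpt_sg_of {n μ : ℕ} (c : Fin μ → Bool) (P : Fin μ → BitString n) (h : allOpt P) :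
    allOpt (sg c P) := fun i => opt_fl _ _ (h i)

lemma allOpt_sg {n μ : ℕ} (c : Fin μ → Bool) (P : Fin μ → BitString n) :
    allOpt (sg c P) ↔ allOpt P :=
  ⟨fun h => by have := allOpt_sg_of c _ h; rwa [sg_sg] at this, allOpt_sg_of c P⟩

lemma iter_done {n μ : ℕ} (hμ : 1 ≤ μ) (h : Bool × Bool → ℝ≥0∞) (T : ℕ) (P : Fin μ → BitString n)
    (b : Bool) : (K^[T] (fun s : State n μ => h s.2)) (P, true, b) = h (true, b) := by
  induction T generalizing P with
  | zero => rfl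
  | succ T ih =>
    rw [Function.iterate_succ_apply']
    have h1 := K_one hμ ((P, true, b) : State n μ)
    generalize K^[T] (fun s : State n μ => h s.2) = G at ih ⊢
    unfold K at h1 ⊢
    have h2 : ∀ Q : Fin μ → BitString n, updFlags (true, b) Q = (true, b) := fun Q => by simp [updFlags]
    simp only [h2, ih, mul_one] at h1 ⊢
    simp_rw [← Finset.sum_mul, ← mul_assoc, ← Finset.sum_mul]
    rw [h1, one_mul]

lemma K_notOpt {n μ : ℕ} (g : State n μ → ℝ≥0∞) (P : Fin μ → BitString n) (h : ¬ allOpt P) :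
    K g (st P) = ∑ i : Fin μ, (μ : ℝ≥0∞)⁻¹ * ∑ y : BitString n, mutProb n (P i) y *
      g (st (nxt P i y)) := by
  unfold K st
  simp only [updFlags, h, if_false, Bool.false_eq_true]

lemma K_sg {n μ : ℕ} (g : State n μ → ℝ≥0∞) (c : Fin μ → Bool) (P : Fin μ → BitString n) (h : ¬ allOpt P) :
    K g (st (sg c P)) = ∑ i : Fin μ, (μ : ℝ≥0∞)⁻¹ * ∑ y : BitString n, mutProb n (P i) y *
      g (st (sg c (nxt P i y))) := by
  rw [K_notOpt g _ (by rwa [allOpt_sg])]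
  refine Finset.sum_congr rfl fun i _ => ?_
  congr 1
  refine Finset.sum_bij' (fun y _ => fl (c i) y) (fun y _ => fl (c i) y) (by simp) (by simp)
    (by simp [fl_fl]) (by simp [fl_fl]) ?_
  intro y _
  rw [← nxt_sg, fl_fl, ← mut_fl (c i) (P i), fl_fl]
  rfl

/-- indicator of first flag -/
def g1 (f : Bool × Bool) : ℝ≥0∞ := if f.1 = true then 1 else 0
/-- indicator of second flag -/
def g2 (f : Bool × Bool) : ℝ≥0∞ := if f.2 = true then 1 else 0

lemma const_ne {n : ℕ} (hn : 1 ≤ n) : allZeros n ≠ allOnes n := by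
  intro h
  have := congrFun h ⟨0, hn⟩
  simp [allZeros, allOnes] at this

lemma count_both {n μ : ℕ} (P : Fin μ → BitString n) (h : allOpt P) :
    (2 : ℝ≥0∞) ^ μ - 2 ≤ ∑ c : Fin μ → Bool, if containsBoth (sg c P) then (1 : ℝ≥0∞) else 0 := by
  have hb : ∀ i, ∃ b : Bool, P i = fun _ => b := by
    intro i
    rcases h i with h | h
    · exact ⟨false, h⟩
    · exact ⟨true, h⟩
  choose b hb using hb
  have hs : ∀ c : Fin μ → Bool, c ∈ (Finset.univ \ {b, fun i => !b i} : Finset (Fin μ → Bool)) →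
      containsBoth (sg c P) := by
    intro c hc
    simp only [Finset.mem_sdiff, Finset.mem_univ, true_and, Finset.mem_insert,
      Finset.mem_singleton, not_or] at hc
    obtain ⟨hc1, hc2⟩ := hc
    obtain ⟨i, hi⟩ := Function.ne_iff.mp hc1
    obtain ⟨j, hj⟩ := Function.ne_iff.mp hc2
    refine ⟨⟨j, ?_⟩, ⟨i, ?_⟩⟩
    · funext k
      have : c j = b j := by revert hj; cases c j <;> cases b j <;> simp
      simp [sg, hb, fl, allZeros, this]
    · funext k
      have : c i = !b i := by revert hi; cases c i <;> cases b i <;> simp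
      simp [sg, hb, fl, allOnes, this]
  calc (2 : ℝ≥0∞) ^ μ - 2 ≤ ((Finset.univ \ {b, fun i => !b i} : Finset (Fin μ → Bool)).card : ℝ≥0∞) := by
        have h1 := Finset.le_card_sdiff ({b, fun i => !b i} : Finset (Fin μ → Bool)) Finset.univ
        have h2 : ({b, fun i => !b i} : Finset (Fin μ → Bool)).card ≤ 2 := Finset.card_le_two
        have h3 : (Finset.univ : Finset (Fin μ → Bool)).card = 2 ^ μ := by simp
        rw [h3] at h1
        rw [tsub_le_iff_right]
        have h4 : 2 ^ μ ≤ (Finset.univ \ {b, fun i => !b i} : Finset (Fin μ → Bool)).card + 2 := by omega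
        exact_mod_cast h4
    _ = ∑ c ∈ (Finset.univ \ {b, fun i => !b i} : Finset (Fin μ → Bool)),
          if containsBoth (sg c P) then (1 : ℝ≥0∞) else 0 := by
        rw [Finset.sum_congr rfl (fun c hc => if_pos (hs c hc))]
        simp
    _ ≤ _ := Finset.sum_le_sum_of_subset (Finset.subset_univ _)

lemma st_opt {n μ : ℕ} (P : Fin μ → BitString n) (h : allOpt P) :
    st P = (P, true, decide (containsBoth P)) := by
  simp [st, updFlags, h]

lemma sym {n μ : ℕ} (hμ : 1 ≤ μ) (T : ℕ) (P : Fin μ → BitString n) :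
    ((2 : ℝ≥0∞) ^ μ - 2) * (K^[T] (fun s : State n μ => g1 s.2)) (st P) ≤
      ∑ c : Fin μ → Bool, (K^[T] (fun s : State n μ => g2 s.2)) (st (sg c P)) := by
  induction T generalizing P with
  | zero =>
    by_cases h : allOpt P
    · simp only [Function.iterate_zero, id, st_opt P h]
      have : ∀ c, g2 (st (sg c P)).2 = if containsBoth (sg c P) then (1 : ℝ≥0∞) else 0 := by
        intro c
        rw [st_opt _ (allOpt_sg_of c P h)]
        simp [g2]
      simp only [this]
      simpa [g1] using count_both P h
    · have : g1 (st P).2 = 0 := by simp [st, updFlags, h, g1]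
      simp [this]
  | succ T ih =>
    by_cases h : allOpt P
    · have h2 : ∀ c, (K^[T+1] (fun s : State n μ => g2 s.2)) (st (sg c P)) =
          if containsBoth (sg c P) then (1 : ℝ≥0∞) else 0 := by
        intro c
        rw [st_opt _ (allOpt_sg_of c P h), iter_done hμ]
        simp [g2]
      simp only [h2]
      rw [st_opt P h, iter_done hμ]
      simpa [g1] using count_both P h
    · simp only [Function.iterate_succ_apply', K_sg _ _ _ h, K_notOpt _ _ h]
      rw [Finset.sum_comm, Finset.mul_sum]
      refine Finset.sum_le_sum fun i _ => ?_
      rw [← Finset.mul_sum, Finset.sum_comm, mul_left_comm, Finset.mul_sum]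
      gcongr with y _
      rw [← Finset.mul_sum, mul_left_comm]
      gcongr
      exact ih _

lemma sum_sg {n μ : ℕ} (G : (Fin μ → BitString n) → ℝ≥0∞) (c : Fin μ → Bool) :
    ∑ P, G (sg c P) = ∑ P, G P :=
  Finset.sum_bij' (fun P _ => sg c P) (fun P _ => sg c P) (by simp) (by simp)
    (by simp [sg_sg]) (by simp [sg_sg]) (by simp)

lemma ex_sym {n μ : ℕ} (hμ : 1 ≤ μ) (T : ℕ) :
    ((2 : ℝ≥0∞) ^ μ - 2) * ex T (fun s : State n μ => g1 s.2) ≤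
      2 ^ μ * ex T (fun s : State n μ => g2 s.2) := by
  rw [ex_iter T, ex_iter T, ex_zero, ex_zero, mul_left_comm, mul_left_comm (2 ^ μ)]
  refine mul_le_mul_right ?_ _
  calc _ = ∑ P : Fin μ → BitString n, ((2 : ℝ≥0∞) ^ μ - 2) * (K^[T] (fun s : State n μ => g1 s.2)) (st P) := by
        rw [Finset.mul_sum]
    _ ≤ ∑ P, ∑ c : Fin μ → Bool, (K^[T] (fun s : State n μ => g2 s.2)) (st (sg c P)) :=
        Finset.sum_le_sum fun P _ => sym hμ T P
    _ = ∑ c : Fin μ → Bool, ∑ P, (K^[T] (fun s : State n μ => g2 s.2)) (st P) := by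
        rw [Finset.sum_comm]
        exact Finset.sum_congr rfl fun c _ =>
          sum_sg (fun P => (K^[T] (fun s : State n μ => g2 s.2)) (st P)) c
    _ = _ := by simp

lemma fin_add {n μ : ℕ} (hμ : 1 ≤ μ) (T : ℕ) :
    ex T (fun s : State n μ => g1 s.2) + nf n μ T = 1 := by
  unfold nf
  rw [probOf_eq]
  refine Eq.trans ?_ (ex_one (n := n) hμ T)
  unfold ex
  rw [← Finset.sum_add_distrib]
  refine Finset.sum_congr rfl fun s _ => ?_
  rw [← mul_add]
  congr 1
  by_cases h : s.2.1 = true <;> simp [g1, h]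

lemma part2 {n μ : ℕ} (hn : 1 ≤ n) (hμ : 1 ≤ μ) :
    1 - ((2 : ℝ≥0∞) ^ (μ - 1))⁻¹ ≤ probBothAtEnd n μ := by
  have hlim : Tendsto (nf n μ) atTop (nhds 0) := by
    apply ENNReal.tendsto_atTop_zero_of_tsum_ne_top
    exact ne_top_of_le_ne_top ENNReal.ofReal_ne_top (exp_bound hn hμ)
  have hstep : ∀ T, (1 - ((2 : ℝ≥0∞) ^ (μ - 1))⁻¹) ≤ probBothAtEnd n μ + nf n μ T := by
    intro T
    set k := 1 - ((2 : ℝ≥0∞) ^ (μ - 1))⁻¹ with hk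
    have h2 : (2 : ℝ≥0∞) ^ μ ≠ 0 := by simp
    have h2' : (2 : ℝ≥0∞) ^ μ ≠ ⊤ := by finiteness
    have hkk : (2 : ℝ≥0∞) ^ μ * k = 2 ^ μ - 2 := by
      rw [hk, ENNReal.mul_sub (fun _ _ => h2'), mul_one]
      congr 1
      obtain ⟨m, rfl⟩ : ∃ m, μ = m + 1 := ⟨μ - 1, by omega⟩
      rw [Nat.add_sub_cancel, pow_succ', mul_assoc, ENNReal.mul_inv_cancel (by simp) (by finiteness), mul_one]
    have h3 : k * ex T (fun s : State n μ => g1 s.2) ≤ ex T (fun s : State n μ => g2 s.2) := by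
      have := ex_sym (n := n) hμ T
      rw [← hkk, mul_assoc] at this
      exact (ENNReal.mul_le_mul_iff_right h2 h2').mp this
    have h4 : ex T (fun s : State n μ => g2 s.2) ≤ probBothAtEnd n μ := by
      refine le_trans (le_of_eq ?_)
        (le_iSup (fun T => probOf (evolve (init n μ) (trans n μ) T) fun s => s.2.2 = true) T)
      rw [probOf_eq]
      congr 1
      funext s
      by_cases h : s.2.2 = true <;> simp [g2, h]
    calc k = k * (ex T (fun s : State n μ => g1 s.2) + nf n μ T) := by rw [fin_add hμ, mul_one]
      _ = k * ex T (fun s : State n μ => g1 s.2) + k * nf n μ T := mul_add _ _ _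
      _ ≤ probBothAtEnd n μ + 1 * nf n μ T := by
        gcongr
        · exact h3.trans h4
        · exact tsub_le_self
      _ = _ := by rw [one_mul]
  have hl2 : Tendsto (fun T => probBothAtEnd n μ + nf n μ T) atTop (nhds (probBothAtEnd n μ + 0)) :=
    tendsto_const_nhds.add hlim
  rw [add_zero] at hl2
  exact ge_of_tendsto' hl2 hstep

/-- adapted from Theorem 4 in Friedrich–Oliveto–Sudholt–Witt:
for every polynomially bounded population size μ = μ(n) ≥ 1, the (μ+1) EA with
deterministic crowding on TwoMax reaches a population consisting only of global optima
in expected O(μ n log n) generations, and the probability that this final population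
contains both optima is at least 1 − 2^(−μ+1). -/
theorem muPlusOneEA_TwoMax_deterministic_crowding
    (μ : ℕ → ℕ) (hμ1 : ∀ n, 1 ≤ μ n)
    (hμ : ∃ C : ℕ, ∀ᶠ n : ℕ in atTop, μ n ≤ n ^ C) :
    (∃ C : ℝ, 0 < C ∧ ∀ᶠ n : ℕ in atTop,
      expAllOpt n (μ n) ≤ ENNReal.ofReal (C * μ n * n * Real.log n)) ∧
    ∀ n : ℕ, 1 ≤ n →
      1 - ((2 : ℝ≥0∞) ^ (μ n - 1))⁻¹ ≤ probBothAtEnd n (μ n) := by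
  exact ⟨part1 μ hμ1 hμ, fun n hn => part2 hn (hμ1 n)⟩

end Stmt3
end
end
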